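/- Let R be a commutative Noetherian semi-local ring with maximal ideals exactly m_1, …, m_t, let a = ∩_{i=1}^t m_i (the Jacobson radical), and let M be a finitely generated R-module of finite dimension d. Then Att_R H^d_a(M) = Assh_R M; in particular, if M ≠ 0 then H^d_a(M) ≠ 0. -/

import Mathlib

/- Common definitions: local cohomology modules, cohomological dimension, module dimension,
secondary representations and attached primes. -/

open CategoryTheory TensorProduct

/-- The `i`-th local cohomology module `H^i_a(M)`, as a type with its `R`-module structure. -/
noncomputable def TopLC (R : Type) [CommRing R] (a : Ideal R) (i : ℕ)
    (M : Type) [AddCommGroup M] [Module R M] : Type :=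
  ((localCohomology a i).obj (ModuleCat.of R M))

noncomputable instance (R : Type) [CommRing R] (a : Ideal R) (i : ℕ)
    (M : Type) [AddCommGroup M] [Module R M] : AddCommGroup (TopLC R a i M) :=
  inferInstanceAs (AddCommGroup ((localCohomology a i).obj (ModuleCat.of R M)))

noncomputable instance (R : Type) [CommRing R] (a : Ideal R) (i : ℕ)
    (M : Type) [AddCommGroup M] [Module R M] : Module R (TopLC R a i M) :=
  inferInstanceAs (Module R ((localCohomology a i).obj (ModuleCat.of R M)))

/-- The cohomological dimension `cd_R(a, M) = sup { i | H^i_a(M) ≠ 0 }`,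
with value `⊥` if all local cohomology modules vanish. -/
noncomputable def cohDim (R : Type) [CommRing R] (a : Ideal R)
    (M : Type) [AddCommGroup M] [Module R M] : WithBot ℕ∞ :=
  sSup {n : WithBot ℕ∞ | ∃ i : ℕ, n = (i : ℕ) ∧ Nontrivial (TopLC R a i M)}

/-- The (Krull) dimension of a module, i.e. the Krull dimension of its support. -/
noncomputable def moduleDim (R : Type) [CommRing R]
    (M : Type) [AddCommGroup M] [Module R M] : WithBot ℕ∞ :=
  Order.krullDim (Module.support R M)

/-- `Assh_R M`: the associated primes `p` of `M` with `dim R/p = dim M`. -/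
noncomputable def Assh (R : Type) [CommRing R]
    (M : Type) [AddCommGroup M] [Module R M] : Set (Ideal R) :=
  { p | p ∈ associatedPrimes R M ∧ ringKrullDim (R ⧸ p) = moduleDim R M }

/-- A submodule `S` is secondary if `S ≠ 0` and every `r : R` acts on `S` either
surjectively or nilpotently. -/
def IsSecondarySub (R : Type) [CommRing R] {M : Type} [AddCommGroup M] [Module R M]
    (S : Submodule R M) : Prop :=
  S ≠ ⊥ ∧ ∀ r : R, (∀ m ∈ S, ∃ s ∈ S, r • s = m) ∨ (∃ n : ℕ, ∀ m ∈ S, r ^ n • m = 0)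

/-- A module is representable if it is the (finite) sum of secondary submodules. -/
def IsRepresentable (R : Type) [CommRing R] (M : Type) [AddCommGroup M] [Module R M] : Prop :=
  ∃ (n : ℕ) (S : Fin n → Submodule R M), (∀ i, IsSecondarySub R (S i)) ∧ (⨆ i, S i) = ⊤

/-- A minimal secondary representation: secondary submodules summing to the whole module,
with pairwise distinct attached primes, none contained in the sum of the others. -/
def IsMinimalRep (R : Type) [CommRing R] {M : Type} [AddCommGroup M] [Module R M]
    {n : ℕ} (S : Fin n → Submodule R M) : Prop :=
  (∀ i, IsSecondarySub R (S i)) ∧ (⨆ i, S i) = ⊤ ∧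
    (Function.Injective fun i => (S i).annihilator.radical) ∧
    ∀ j, ¬ (S j ≤ ⨆ i ∈ ({j}ᶜ : Set (Fin n)), S i)

/-- The attached primes of a module: the radicals of the annihilators of the terms of a
minimal secondary representation. -/
def AttachedPrimes (R : Type) [CommRing R] (M : Type) [AddCommGroup M] [Module R M] :
    Set (Ideal R) :=
  { p | ∃ (n : ℕ) (S : Fin n → Submodule R M), IsMinimalRep R S ∧
      ∃ i, p = (S i).annihilator.radical }

/-- `stab b N = ⟨b⟩N = ⋂ₙ bⁿN`. -/
def stab {R M : Type} [CommRing R] [AddCommGroup M] [Module R M]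
    (b : Ideal R) (N : Submodule R M) : Submodule R M :=
  ⨅ n : ℕ, b ^ n • N

section ExtComparison

open Opposite

variable {R : Type} [CommRing R] {X X' Y Y' : ModuleCat.{0} R}

/-- The complex in the opposite category whose homology computes `Ext` from a projective
resolution. -/
noncomputable def resHom (P : ProjectiveResolution X) (Y : ModuleCat.{0} R) :
    ChainComplex (ModuleCat.{0} R)ᵒᵖ ℕ :=
  (((linearYoneda R (ModuleCat.{0} R)).obj Y).rightOp.mapHomologicalComplex _).obj P.complex

/-- The left derived functors defining `Ext` are the homology of `resHom`. -/
noncomputable def resIso (P : ProjectiveResolution X) (Y : ModuleCat.{0} R) (n : ℕ) :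
    (((linearYoneda R (ModuleCat.{0} R)).obj Y).rightOp.leftDerived n).obj X ≅
      (resHom P Y).homology n :=
  P.isoLeftDerivedObj ((linearYoneda R (ModuleCat.{0} R)).obj Y).rightOp n

/-- The projection from `n`-cocycles of `resHom P Y` to `Ext`. -/
noncomputable def cocycleClass (P : ProjectiveResolution X) (Y : ModuleCat.{0} R) (n : ℕ) :
    ((resHom P Y).opcycles n).unop ⟶ ((_root_.Ext R (ModuleCat.{0} R) n).obj (op X)).obj Y :=
  ((resIso P Y n).hom ≫ (resHom P Y).homologyι n).unop

/-- The inclusion of the `n`-cocycles of `resHom P Y` into the homomorphisms. -/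
noncomputable def cocycleIncl (P : ProjectiveResolution X) (Y : ModuleCat.{0} R) (n : ℕ) :
    ((resHom P Y).opcycles n).unop ⟶ ModuleCat.of R (P.complex.X n ⟶ Y) :=
  ((resHom P Y).pOpcycles n).unop

instance (P : ProjectiveResolution X) (n : ℕ) : Mono (cocycleIncl P Y n) :=
  unop_mono_of_epi ((resHom P Y).pOpcycles n)

lemma cocycleIncl_injective (P : ProjectiveResolution X) (n : ℕ) :
    Function.Injective (cocycleIncl P Y n).hom :=
  (ModuleCat.mono_iff_injective _).mp inferInstance

lemma cocycleClass_surjective (P : ProjectiveResolution X) (n : ℕ) :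
    Function.Surjective (cocycleClass P Y n).hom := by
  have : Epi (cocycleClass P Y n) := by
    have : Mono ((resIso P Y n).hom ≫ (resHom P Y).homologyι n) := by
      have : Mono ((resHom P Y).homologyι n) := inferInstanceAs
        (Mono ((resHom P Y).sc n).homologyι)
      infer_instance
    exact unop_epi_of_mono ((resIso P Y n).hom ≫ (resHom P Y).homologyι n)
  exact (ModuleCat.epi_iff_surjective _).mp this

lemma mem_range_cocycleIncl (P : ProjectiveResolution X) (n : ℕ) (f : P.complex.X n ⟶ Y) :
    (∃ z, (cocycleIncl P Y n).hom z = f) ↔ P.complex.d (n + 1) n ≫ f = 0 := by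
  let K := resHom P Y
  have hex : (ShortComplex.mk (K.d (n+1) n) (K.pOpcycles n) (K.d_pOpcycles _ _)).Exact :=
    ShortComplex.exact_of_g_is_cokernel _ (K.opcyclesIsCokernel (n+1) n (by simp))
  have h2 := (ShortComplex.moduleCat_exact_iff _).mp hex.unop
  constructor
  · rintro ⟨z, rfl⟩
    have := congrArg (fun t => t.unop.hom z) (K.d_pOpcycles (n+1) n)
    exact this
  · intro hf
    exact h2 f hf

lemma cocycleClass_eq_zero_iff (P : ProjectiveResolution X) (n m : ℕ)
    (hm : (ComplexShape.down ℕ).next n = m) 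
    (z : ((resHom P Y).opcycles n).unop) :
    (cocycleClass P Y n).hom z = 0 ↔
      ∃ g : P.complex.X m ⟶ Y, P.complex.d n m ≫ g = (cocycleIncl P Y n).hom z := by
  let K := resHom P Y
  have hex : (ShortComplex.mk (K.homologyι n) (K.fromOpcycles n m)
      (K.homologyι_comp_fromOpcycles n m)).Exact :=
    ShortComplex.exact_of_f_is_kernel _ (K.homologyIsKernel n m hm)
  have h2 := (ShortComplex.moduleCat_exact_iff _).mp hex.unop
  have h3 : ∀ g : P.complex.X m ⟶ Y,
      (cocycleIncl P Y n).hom ((K.fromOpcycles n m).unop.hom g) = P.complex.d n m ≫ g := by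
    intro g
    have := congrArg (fun t => t.unop.hom g) (K.p_fromOpcycles n m)
    exact this
  have h4 : (cocycleClass P Y n).hom z = 0 ↔ (K.homologyι n).unop.hom z = 0 := by
    let i := (resIso P Y n).hom.unop
    have hi : Function.Injective i.hom := (ModuleCat.mono_iff_injective _).mp inferInstance
    exact map_eq_zero_iff i.hom hi
  rw [h4]
  constructor
  · intro h
    obtain ⟨g, hg⟩ := h2 z h
    exact ⟨g, (h3 g).symm.trans (congrArg _ hg)⟩
  · rintro ⟨g, hg⟩
    rw [← h3] at hg
    rw [← cocycleIncl_injective _ _ hg]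
    exact congrArg (fun t => t.unop.hom g) (K.homologyι_comp_fromOpcycles n m)


lemma exists_cocycle_precomp {P : ProjectiveResolution X} {P' : ProjectiveResolution X'}
    {g : X' ⟶ X} (φ : ProjectiveResolution.Hom P' P g) (n : ℕ)
    (z : ((resHom P Y).opcycles n).unop) :
    ∃ z' : ((resHom P' Y).opcycles n).unop,
      (cocycleIncl P' Y n).hom z' = φ.hom.f n ≫ (cocycleIncl P Y n).hom z ∧
      (cocycleClass P' Y n).hom z' =
        (((_root_.Ext R (ModuleCat.{0} R) n).map g.op).app Y).hom ((cocycleClass P Y n).hom z) := by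
  let F := ((linearYoneda R (ModuleCat.{0} R)).obj Y).rightOp
  let Φ : resHom P' Y ⟶ resHom P Y := (F.mapHomologicalComplex _).map φ.hom
  refine ⟨(HomologicalComplex.opcyclesMap Φ n).unop.hom z, ?_, ?_⟩
  · exact congrArg (fun t => t.unop.hom z) (HomologicalComplex.p_opcyclesMap Φ n)
  · have h1 := HomologicalComplex.homologyι_naturality Φ n
    have h2 : (F.leftDerived n).map g ≫ (resIso P Y n).hom =
        (resIso P' Y n).hom ≫ HomologicalComplex.homologyMap Φ n :=
      ProjectiveResolution.isoLeftDerivedObj_hom_naturality g P' P φ.hom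
        (by simpa using φ.hom_f_zero_comp_π_f_zero) F n
    have h3 : (F.leftDerived n).map g ≫ (resIso P Y n).hom ≫
        (resHom P Y).homologyι n = (resIso P' Y n).hom ≫
          (resHom P' Y).homologyι n ≫ HomologicalComplex.opcyclesMap Φ n := by
      rw [← h1, ← Category.assoc, h2, Category.assoc]
    exact (congrArg (fun t => t.unop.hom z) h3).symm

lemma exists_cocycle_postcomp (P : ProjectiveResolution X) (h : Y ⟶ Y') (n : ℕ)
    (z : ((resHom P Y).opcycles n).unop) :
    ∃ z' : ((resHom P Y').opcycles n).unop,
      (cocycleIncl P Y' n).hom z' = (cocycleIncl P Y n).hom z ≫ h ∧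
      (cocycleClass P Y' n).hom z' =
        (((_root_.Ext R (ModuleCat.{0} R) n).obj (op X)).map h).hom ((cocycleClass P Y n).hom z) := by
  let α := NatTrans.rightOp ((linearYoneda R (ModuleCat.{0} R)).map h)
  let Φ : resHom P Y' ⟶ resHom P Y := (NatTrans.mapHomologicalComplex α _).app P.complex
  refine ⟨(HomologicalComplex.opcyclesMap Φ n).unop.hom z, ?_, ?_⟩
  · exact congrArg (fun t => t.unop.hom z) (HomologicalComplex.p_opcyclesMap Φ n)
  · have h1 := HomologicalComplex.homologyι_naturality Φ n
    have h2 : (NatTrans.leftDerived α n).app X = (resIso P Y' n).hom ≫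
        HomologicalComplex.homologyMap Φ n ≫ (resIso P Y n).inv :=
      ProjectiveResolution.leftDerived_app_eq α P n
    have h3 : (NatTrans.leftDerived α n).app X ≫ (resIso P Y n).hom ≫
        (resHom P Y).homologyι n = (resIso P Y' n).hom ≫
          (resHom P Y').homologyι n ≫ HomologicalComplex.opcyclesMap Φ n := by
      rw [← h1, h2]
      simp only [Category.assoc, Iso.inv_hom_id_assoc]
    exact (congrArg (fun t => t.unop.hom z) h3).symm

lemma extMk_eq_zero_iff_of_next (P : ProjectiveResolution X) (n m : ℕ)
    (hm : (ComplexShape.down ℕ).next n = m) (f : P.complex.X n ⟶ Y)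
    (hf : P.complex.d (n + 1) n ≫ f = 0) :
    P.extMk f (n + 1) rfl hf = 0 ↔ ∃ g : P.complex.X m ⟶ Y, P.complex.d n m ≫ g = f := by
  cases n with
  | succ p =>
    obtain rfl : p = m := by
      rw [← hm]; exact ((ComplexShape.down ℕ).next_eq' (by simp)).symm
    exact P.extMk_eq_zero_iff f _ rfl hf p rfl
  | zero =>
    have h0 : (∃ g : P.complex.X m ⟶ Y, P.complex.d 0 m ≫ g = f) ↔ f = 0 := by
      simp [eq_comm]
    rw [h0]
    constructor
    · intro h
      rw [← P.extEquivCohomologyClass.apply_eq_iff_eq,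
        ProjectiveResolution.extEquivCohomologyClass_extMk,
        ProjectiveResolution.extEquivCohomologyClass_zero,
        CochainComplex.HomComplex.CohomologyClass.mk_eq_zero_iff,
        CochainComplex.HomComplex.Cocycle.toSingleMk_mem_coboundaries_iff _ _ _ _ _ 1 (by simp)] at h
      obtain ⟨g, hg⟩ := h
      have hX : Limits.IsZero (P.cochainComplex.X 1) :=
        P.cochainComplex.isZero_of_isStrictlyLE 0 1
      rw [hX.eq_of_src g 0, Limits.comp_zero] at hg
      rw [← cancel_epi (P.cochainComplexXIso (-(0:ℕ)) 0 rfl).hom, ← hg, Limits.comp_zero]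
    · rintro rfl
      simp

/-- The class in `Abelian.Ext` of a cocycle. -/
noncomputable def newCocycleClass (P : ProjectiveResolution X) (Y : ModuleCat.{0} R) (n : ℕ) :
    ((resHom P Y).opcycles n).unop →ₗ[R] Abelian.Ext X Y n where
  toFun z := P.extMk ((cocycleIncl P Y n).hom z) (n + 1) rfl
    ((mem_range_cocycleIncl P n _).mp ⟨z, rfl⟩)
  map_add' z z' := by
    rw [P.add_extMk]
    congr 1
    exact (cocycleIncl P Y n).hom.map_add z z'
  map_smul' r z := by
    rw [RingHom.id_apply, Abelian.Ext.smul_eq_comp_mk₀, P.extMk_comp_mk₀]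
    congr 1
    refine ((cocycleIncl P Y n).hom.map_smul r z).trans ?_
    simp [Linear.comp_smul]

lemma newCocycleClass_apply (P : ProjectiveResolution X) (n : ℕ)
    (z : ((resHom P Y).opcycles n).unop) :
    newCocycleClass P Y n z = P.extMk ((cocycleIncl P Y n).hom z) (n + 1) rfl
      ((mem_range_cocycleIncl P n _).mp ⟨z, rfl⟩) := rfl

lemma newCocycleClass_surjective (P : ProjectiveResolution X) (n : ℕ) :
    Function.Surjective (newCocycleClass P Y n) := by
  intro e
  obtain ⟨f, hf, rfl⟩ := P.extMk_surjective e (n + 1) rfl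
  obtain ⟨z, rfl⟩ := (mem_range_cocycleIncl P n f).mpr hf
  exact ⟨z, rfl⟩

lemma ker_newCocycleClass (P : ProjectiveResolution X) (n : ℕ) :
    LinearMap.ker (newCocycleClass P Y n) = LinearMap.ker (cocycleClass P Y n).hom := by
  ext z
  rw [LinearMap.mem_ker, LinearMap.mem_ker, newCocycleClass_apply,
    extMk_eq_zero_iff_of_next P n _ rfl, cocycleClass_eq_zero_iff P n _ rfl]

/-- The comparison between the two definitions of `Ext`. -/
noncomputable def extCompare (P : ProjectiveResolution X) (Y : ModuleCat.{0} R) (n : ℕ) :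
    Abelian.Ext X Y n ≃ₗ[R] ((_root_.Ext R (ModuleCat.{0} R) n).obj (op X)).obj Y :=
  ((newCocycleClass P Y n).quotKerEquivOfSurjective (newCocycleClass_surjective P n)).symm ≪≫ₗ
    Submodule.quotEquivOfEq _ _ (ker_newCocycleClass P n) ≪≫ₗ
    (cocycleClass P Y n).hom.quotKerEquivOfSurjective (cocycleClass_surjective P n)

lemma extCompare_newCocycleClass (P : ProjectiveResolution X) (n : ℕ)
    (z : ((resHom P Y).opcycles n).unop) :
    extCompare P Y n (newCocycleClass P Y n z) = (cocycleClass P Y n).hom z := by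
  have : ((newCocycleClass P Y n).quotKerEquivOfSurjective (newCocycleClass_surjective P n)).symm
      (newCocycleClass P Y n z) = Submodule.Quotient.mk z := by
    rw [LinearEquiv.symm_apply_eq]; rfl
  simp only [extCompare, LinearEquiv.trans_apply, this]
  rfl

lemma extCompare_precomp (P : ProjectiveResolution X) (P' : ProjectiveResolution X')
    (g : X' ⟶ X) (n : ℕ) (e : Abelian.Ext X Y n) :
    extCompare P' Y n ((Abelian.Ext.mk₀ g).comp e (zero_add n)) =
      (((_root_.Ext R (ModuleCat.{0} R) n).map g.op).app Y).hom (extCompare P Y n e) := by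
  obtain ⟨z, rfl⟩ := newCocycleClass_surjective P n e
  let φ : ProjectiveResolution.Hom P' P g :=
    ⟨ProjectiveResolution.lift g P' P,
      (ProjectiveResolution.lift_commutes_zero g P' P).trans (by simp)⟩
  obtain ⟨z', h1, h2⟩ := exists_cocycle_precomp φ n z
  rw [extCompare_newCocycleClass, ← h2, ← extCompare_newCocycleClass]
  congr 1
  rw [newCocycleClass_apply, newCocycleClass_apply, ProjectiveResolution.mk₀_comp_extMk _ _ _ _ φ]
  simp only [h1]

lemma extCompare_postcomp (P : ProjectiveResolution X)
    (h : Y ⟶ Y') (n : ℕ) (e : Abelian.Ext X Y n) :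
    extCompare P Y' n (e.comp (Abelian.Ext.mk₀ h) (add_zero n)) =
      (((_root_.Ext R (ModuleCat.{0} R) n).obj (op X)).map h).hom (extCompare P Y n e) := by
  obtain ⟨z, rfl⟩ := newCocycleClass_surjective P n e
  obtain ⟨z', h1, h2⟩ := exists_cocycle_postcomp P h n z
  rw [extCompare_newCocycleClass, ← h2, ← extCompare_newCocycleClass]
  congr 1
  rw [newCocycleClass_apply, newCocycleClass_apply, ProjectiveResolution.extMk_comp_mk₀]
  simp only [h1]

end ExtComparison

section LocalCohomologyClasses

open Opposite Limits

variable {R : Type} [CommRing R] (a : Ideal R)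

/-- The canonical projection `R / a ^ n' → R / a ^ n`. -/
noncomputable def powProj {n n' : ℕ} (h : n ≤ n') :
    ModuleCat.of R (R ⧸ a ^ n') ⟶ ModuleCat.of R (R ⧸ a ^ n) :=
  ModuleCat.ofHom (Submodule.mapQ _ _ LinearMap.id (Ideal.pow_le_pow_right h))

/-- The structure map of the colimit defining `H^i_a(M)`. -/
noncomputable def lcι (i n : ℕ) (M : Type) [AddCommGroup M] [Module R M] :
    ((_root_.Ext R (ModuleCat.{0} R) i).obj (op (ModuleCat.of R (R ⧸ a ^ n)))).obj
      (ModuleCat.of R M) →ₗ[R] TopLC R a i M :=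
  ((colimit.ι (localCohomology.diagram (localCohomology.idealPowersDiagram a) i)
    (op (op n))).app (ModuleCat.of R M)).hom

/-- The class in `H^i_a(M)` of an element of `Ext^i(R / a ^ n, M)`. -/
noncomputable def lcClass (i n : ℕ) (M : Type) [AddCommGroup M] [Module R M] :
    Abelian.Ext (ModuleCat.of R (R ⧸ a ^ n)) (ModuleCat.of R M) i →ₗ[R] TopLC R a i M :=
  lcι a i n M ∘ₗ
    (extCompare (projectiveResolution (ModuleCat.of R (R ⧸ a ^ n))) (ModuleCat.of R M) i).toLinearMap

/-- The map induced on local cohomology. -/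
noncomputable def TopLC.map (i : ℕ) {M N : Type} [AddCommGroup M] [Module R M] [AddCommGroup N]
    [Module R N] (f : M →ₗ[R] N) : TopLC R a i M →ₗ[R] TopLC R a i N :=
  ((localCohomology a i).map (ModuleCat.ofHom f)).hom

variable {M N : Type} [AddCommGroup M] [Module R M] [AddCommGroup N] [Module R N]

lemma map_lcClass (i n : ℕ) (f : M →ₗ[R] N)
    (e : Abelian.Ext (ModuleCat.of R (R ⧸ a ^ n)) (ModuleCat.of R M) i) :
    TopLC.map a i f (lcClass a i n M e) =
      lcClass a i n N (e.comp (Abelian.Ext.mk₀ (ModuleCat.ofHom f)) (add_zero i)) := by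
  simp only [lcClass, LinearMap.comp_apply, LinearEquiv.coe_coe]
  rw [extCompare_postcomp]
  exact (ConcreteCategory.congr_hom ((colimit.ι (localCohomology.diagram
    (localCohomology.idealPowersDiagram a) i) (op (op n))).naturality (ModuleCat.ofHom f)) _).symm

lemma lcClass_precomp (i : ℕ) {n n' : ℕ} (h : n ≤ n')
    (e : Abelian.Ext (ModuleCat.of R (R ⧸ a ^ n)) (ModuleCat.of R M) i) :
    lcClass a i n' M ((Abelian.Ext.mk₀ (powProj a h)).comp e (zero_add i)) = lcClass a i n M e := by
  simp only [lcClass, LinearMap.comp_apply, LinearEquiv.coe_coe]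
  rw [extCompare_precomp (projectiveResolution (ModuleCat.of R (R ⧸ a ^ n)))]
  have := congr_arg (fun φ => φ.app (ModuleCat.of R M)) (colimit.w (localCohomology.diagram
    (localCohomology.idealPowersDiagram a) i) (homOfLE h).op.op)
  exact ConcreteCategory.congr_hom this _

/-- Local cohomology of a module as a filtered colimit. -/
noncomputable def lcIsColimit (i : ℕ) (M : Type) [AddCommGroup M] [Module R M] :
    IsColimit (((evaluation _ _).obj (ModuleCat.of R M)).mapCocone (colimit.cocone
      (localCohomology.diagram (localCohomology.idealPowersDiagram a) i))) :=
  isColimitOfPreserves ((evaluation _ _).obj (ModuleCat.of R M)) (colimit.isColimit _)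

lemma exists_lcClass_eq (i : ℕ) (x : TopLC R a i M) : ∃ n e, lcClass a i n M e = x := by
  obtain ⟨j, y, hy⟩ := Concrete.isColimit_exists_rep _ (lcIsColimit a i M) x
  refine ⟨j.unop.unop, (extCompare (projectiveResolution _) (ModuleCat.of R M) i).symm y, ?_⟩
  exact (congrArg (lcι a i j.unop.unop M) (LinearEquiv.apply_symm_apply _ _)).trans hy

lemma lcClass_eq_zero_iff (i n : ℕ)
    (e : Abelian.Ext (ModuleCat.of R (R ⧸ a ^ n)) (ModuleCat.of R M) i) :
    lcClass a i n M e = 0 ↔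
      ∃ n', ∃ h : n ≤ n', (Abelian.Ext.mk₀ (powProj a h)).comp e (zero_add i) = 0 := by
  constructor
  · intro h0
    let y := extCompare (projectiveResolution _) (ModuleCat.of R M) i e
    have h1 : (((evaluation _ _).obj (ModuleCat.of R M)).mapCocone (colimit.cocone
      (localCohomology.diagram (localCohomology.idealPowersDiagram a) i))).ι.app (op (op n)) y =
      (((evaluation _ _).obj (ModuleCat.of R M)).mapCocone (colimit.cocone
      (localCohomology.diagram (localCohomology.idealPowersDiagram a) i))).ι.app (op (op n)) 0 := by
      rw [map_zero]
      exact h0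
    obtain ⟨k, f, g, hk⟩ := Concrete.isColimit_exists_of_rep_eq _ (lcIsColimit a i M) _ _ h1
    rw [map_zero] at hk
    refine ⟨k.unop.unop, f.unop.unop.le, ?_⟩
    apply (extCompare (projectiveResolution _) (ModuleCat.of R M) i).injective
    rw [extCompare_precomp (projectiveResolution (ModuleCat.of R (R ⧸ a ^ n))), map_zero]
    exact hk
  · rintro ⟨n', h, h0⟩
    rw [← lcClass_precomp a i h, h0, map_zero]

end LocalCohomologyClasses

section LocalCohomologyExactness

open Opposite Limits

variable {R : Type} [CommRing R] (a : Ideal R)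
variable {L M N : Type} [AddCommGroup L] [Module R L] [AddCommGroup M] [Module R M]
  [AddCommGroup N] [Module R N]

/-- Pulling back classes of extensions along `R / a ^ n' → R / a ^ n`. -/
noncomputable def extPull {n n' : ℕ} (h : n ≤ n') (i : ℕ) (Y : ModuleCat.{0} R) :
    Abelian.Ext (ModuleCat.of R (R ⧸ a ^ n)) Y i →+
      Abelian.Ext (ModuleCat.of R (R ⧸ a ^ n')) Y i :=
  (Abelian.Ext.mk₀ (powProj a h)).precomp Y (zero_add i)

lemma lcClass_extPull (i : ℕ) {n n' : ℕ} (h : n ≤ n')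
    (e : Abelian.Ext (ModuleCat.of R (R ⧸ a ^ n)) (ModuleCat.of R M) i) :
    lcClass a i n' M (extPull a h i _ e) = lcClass a i n M e :=
  lcClass_precomp a i h e

lemma lcClass_eq_zero_iff_extPull (i n : ℕ)
    (e : Abelian.Ext (ModuleCat.of R (R ⧸ a ^ n)) (ModuleCat.of R M) i) :
    lcClass a i n M e = 0 ↔ ∃ n', ∃ h : n ≤ n', extPull a h i _ e = 0 :=
  lcClass_eq_zero_iff a i n e

lemma extPull_comp {n n' : ℕ} (h : n ≤ n') {i j k : ℕ} {Y Z : ModuleCat.{0} R}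
    (e : Abelian.Ext (ModuleCat.of R (R ⧸ a ^ n)) Y i) (e' : Abelian.Ext Y Z j) (hk : i + j = k) :
    extPull a h k Z (e.comp e' hk) = (extPull a h i Y e).comp e' hk :=
  (Abelian.Ext.comp_assoc _ e e' (zero_add i) hk (by omega)).symm

lemma exists_lcClass_eq_two {i j : ℕ} (x : TopLC R a i M) (y : TopLC R a j N) :
    ∃ n e e', lcClass a i n M e = x ∧ lcClass a j n N e' = y := by
  obtain ⟨n, e, rfl⟩ := exists_lcClass_eq a i x
  obtain ⟨n', e', rfl⟩ := exists_lcClass_eq a j y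
  exact ⟨max n n', extPull a (le_max_left _ _) i _ e, extPull a (le_max_right _ _) j _ e',
    lcClass_extPull .., lcClass_extPull ..⟩

lemma TopLC.map_comp (i : ℕ) (f : L →ₗ[R] M) (g : M →ₗ[R] N) :
    TopLC.map a i (g ∘ₗ f) = TopLC.map a i g ∘ₗ TopLC.map a i f := by
  have := (localCohomology a i).map_comp (ModuleCat.ofHom f) (ModuleCat.ofHom g)
  exact congrArg ModuleCat.Hom.hom this

lemma TopLC.map_id (i : ℕ) : TopLC.map a i (LinearMap.id : M →ₗ[R] M) = LinearMap.id := by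
  have := (localCohomology a i).map_id (ModuleCat.of R M)
  exact congrArg ModuleCat.Hom.hom this

lemma TopLC.map_add (i : ℕ) (f g : M →ₗ[R] N) :
    TopLC.map a i (f + g) = TopLC.map a i f + TopLC.map a i g := by
  ext x
  obtain ⟨n, e, rfl⟩ := exists_lcClass_eq a i x
  rw [LinearMap.add_apply, map_lcClass, map_lcClass, map_lcClass, ← _root_.map_add,
    ← Abelian.Ext.comp_add, ← Abelian.Ext.mk₀_add]
  rfl

lemma TopLC.map_smul (i : ℕ) (r : R) (f : M →ₗ[R] N) :
    TopLC.map a i (r • f) = r • TopLC.map a i f := by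
  ext x
  obtain ⟨n, e, rfl⟩ := exists_lcClass_eq a i x
  rw [LinearMap.smul_apply, map_lcClass, map_lcClass, ← _root_.map_smul,
    ← Abelian.Ext.comp_smul, ← Abelian.Ext.mk₀_smul]
  rfl

/-- The map induced on local cohomology, as a linear map. -/
noncomputable def TopLC.mapₗ (i : ℕ) (M N : Type) [AddCommGroup M] [Module R M] [AddCommGroup N]
    [Module R N] : (M →ₗ[R] N) →ₗ[R] (TopLC R a i M →ₗ[R] TopLC R a i N) where
  toFun := TopLC.map a i
  map_add' := TopLC.map_add a i
  map_smul' := TopLC.map_smul a i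

lemma TopLC.map_zero (i : ℕ) : TopLC.map a i (0 : M →ₗ[R] N) = 0 :=
  _root_.map_zero (TopLC.mapₗ a i M N)

lemma TopLC.map_injective_zero {f : M →ₗ[R] N} (hf : Function.Injective f) :
    Function.Injective (TopLC.map a 0 f) := by
  rw [injective_iff_map_eq_zero]
  intro x hx
  obtain ⟨n, e, rfl⟩ := exists_lcClass_eq a 0 x
  rw [map_lcClass, lcClass_eq_zero_iff_extPull] at hx
  obtain ⟨n', h, hx⟩ := hx
  rw [extPull_comp] at hx
  rw [← lcClass_extPull a 0 h]
  have : Mono (ModuleCat.ofHom f) := (ModuleCat.mono_iff_injective _).mpr hf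
  have h2 := Abelian.Ext.postcomp_mk₀_injective_of_mono (ModuleCat.of R (R ⧸ a ^ n'))
    (ModuleCat.ofHom f)
  rw [(injective_iff_map_eq_zero _).mp h2 _ hx, _root_.map_zero]

variable {f : L →ₗ[R] M} {g : M →ₗ[R] N}

lemma shortExact_of_exact (hf : Function.Injective f) (hfg : Function.Exact f g)
    (hg : Function.Surjective g) :
    (ShortComplex.mk (ModuleCat.ofHom f) (ModuleCat.ofHom g)
      (by ext x; exact hfg.apply_apply_eq_zero x)).ShortExact :=
  ModuleCat.shortComplex_shortExact _ hfg hf hg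

lemma TopLC.exact_map (i : ℕ) (hf : Function.Injective f) (hfg : Function.Exact f g)
    (hg : Function.Surjective g) :
    Function.Exact (TopLC.map a i f) (TopLC.map a i g) := by
  intro x
  constructor
  · intro hx
    obtain ⟨n, e, rfl⟩ := exists_lcClass_eq a i x
    rw [map_lcClass, lcClass_eq_zero_iff_extPull] at hx
    obtain ⟨n', h, hx⟩ := hx
    rw [extPull_comp] at hx
    obtain ⟨e', he'⟩ := Abelian.Ext.covariant_sequence_exact₂ _ (shortExact_of_exact hf hfg hg) _ hx
    refine ⟨lcClass a i n' L e', ?_⟩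
    rw [map_lcClass, ← lcClass_extPull a i h]
    exact congrArg _ he'
  · rintro ⟨y, rfl⟩
    rw [← LinearMap.comp_apply, ← TopLC.map_comp, hfg.linearMap_comp_eq_zero, TopLC.map_zero]
    rfl

lemma TopLC.exists_connecting (i : ℕ) (hf : Function.Injective f) (hfg : Function.Exact f g)
    (hg : Function.Surjective g) :
    ∃ δ : TopLC R a i N →ₗ[R] TopLC R a (i + 1) L,
      Function.Exact (TopLC.map a i g) δ ∧ Function.Exact δ (TopLC.map a (i + 1) f) := by
  have S := shortExact_of_exact hf hfg hg
  let d : ∀ n, Abelian.Ext (ModuleCat.of R (R ⧸ a ^ n)) (ModuleCat.of R N) i →ₗ[R]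
      Abelian.Ext (ModuleCat.of R (R ⧸ a ^ n)) (ModuleCat.of R L) (i + 1) := fun n ↦
    { toFun := fun e ↦ e.comp S.extClass rfl
      map_add' := fun _ _ ↦ Abelian.Ext.add_comp _ _ _ _
      map_smul' := fun r _ ↦ Abelian.Ext.smul_comp _ _ _ _ }
  have hd : ∀ {n n'} (h : n ≤ n') e, extPull a h _ _ (d n e) = d n' (extPull a h _ _ e) :=
    fun h e ↦ extPull_comp a h e _ rfl
  have key : ∀ x : TopLC R a i N, ∃ y : TopLC R a (i + 1) L, ∀ n e, lcClass a i n N e = x →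
      lcClass a (i + 1) n L (d n e) = y := by
    intro x
    obtain ⟨n, e, rfl⟩ := exists_lcClass_eq a i x
    refine ⟨lcClass a (i + 1) n L (d n e), fun n' e' he ↦ ?_⟩
    have h1 : lcClass a i (max n n') N (extPull a (le_max_right _ _) i _ e' -
        extPull a (le_max_left _ _) i _ e) = 0 := by
      rw [_root_.map_sub, lcClass_extPull, lcClass_extPull, he, sub_self]
    rw [lcClass_eq_zero_iff_extPull] at h1
    obtain ⟨k, h, h1⟩ := h1
    rw [← lcClass_extPull a (i + 1) (le_max_right n n'),
      ← lcClass_extPull a (i + 1) (le_max_left n n'), ← sub_eq_zero, ← _root_.map_sub,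
      lcClass_eq_zero_iff_extPull]
    refine ⟨k, h, ?_⟩
    rw [hd, hd, ← _root_.map_sub, hd, h1, _root_.map_zero]
  choose δ hδ using key
  have hδ' : ∀ n e, δ (lcClass a i n N e) = lcClass a (i + 1) n L (d n e) :=
    fun n e ↦ (hδ _ n e rfl).symm
  refine ⟨⟨⟨δ, ?_⟩, ?_⟩, ?_, ?_⟩
  · intro x y
    obtain ⟨n, e, e', rfl, rfl⟩ := exists_lcClass_eq_two a x y
    rw [← _root_.map_add, hδ', hδ', hδ', _root_.map_add, _root_.map_add]
  · intro r x
    obtain ⟨n, e, rfl⟩ := exists_lcClass_eq a i x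
    change δ (r • _) = r • δ _
    rw [← _root_.map_smul, hδ', hδ', _root_.map_smul, _root_.map_smul]
  · intro x
    change δ x = 0 ↔ _
    constructor
    · intro hx
      obtain ⟨n, e, rfl⟩ := exists_lcClass_eq a i x
      rw [hδ', lcClass_eq_zero_iff_extPull] at hx
      obtain ⟨n', h, hx⟩ := hx
      rw [hd] at hx
      obtain ⟨e', he'⟩ := Abelian.Ext.covariant_sequence_exact₃ _ S _ rfl hx
      refine ⟨lcClass a i n' M e', ?_⟩
      rw [map_lcClass, ← lcClass_extPull a i h]
      exact congrArg _ he'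
    · rintro ⟨y, rfl⟩
      obtain ⟨n, e, rfl⟩ := exists_lcClass_eq a i y
      rw [map_lcClass, hδ']
      have : d n (e.comp (Abelian.Ext.mk₀ (ModuleCat.ofHom g)) (add_zero i)) = 0 := by
        have h := S.comp_extClass
        exact (Abelian.Ext.comp_assoc_of_second_deg_zero e _ S.extClass rfl).trans
          ((congrArg (fun z ↦ e.comp z rfl) h).trans (Abelian.Ext.comp_zero _ _ _ _ _))
      rw [this, _root_.map_zero]
  · intro x
    change _ ↔ x ∈ Set.range δ
    constructor
    · intro hx
      obtain ⟨n, e, rfl⟩ := exists_lcClass_eq a (i + 1) x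
      rw [map_lcClass, lcClass_eq_zero_iff_extPull] at hx
      obtain ⟨n', h, hx⟩ := hx
      rw [extPull_comp] at hx
      obtain ⟨e', he'⟩ := Abelian.Ext.covariant_sequence_exact₁ _ S _ hx rfl
      refine ⟨lcClass a i n' N e', ?_⟩
      rw [hδ', ← lcClass_extPull a (i + 1) h]
      exact congrArg _ he'
    · rintro ⟨y, rfl⟩
      obtain ⟨n, e, rfl⟩ := exists_lcClass_eq a i y
      rw [hδ', map_lcClass]
      have : (d n e).comp (Abelian.Ext.mk₀ (ModuleCat.ofHom f)) (add_zero (i + 1)) = 0 := by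
        have h := S.extClass_comp
        exact (Abelian.Ext.comp_assoc_of_third_deg_zero e S.extClass _ rfl).trans
          ((congrArg (fun z ↦ e.comp z rfl) h).trans (Abelian.Ext.comp_zero _ _ _ _ _))
      rw [this, _root_.map_zero]

lemma TopLC.exists_pow_smul_eq_zero (i : ℕ) (x : TopLC R a i M) :
    ∃ n, ∀ r ∈ a ^ n, r • x = 0 := by
  obtain ⟨n, e, rfl⟩ := exists_lcClass_eq a i x
  refine ⟨n, fun r hr ↦ ?_⟩
  rw [← _root_.map_smul]
  have h1 : r • e = (Abelian.Ext.mk₀ (r • 𝟙 (ModuleCat.of R (R ⧸ a ^ n)))).comp e (zero_add i) := by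
    rw [Abelian.Ext.mk₀_smul, Abelian.Ext.smul_comp, Abelian.Ext.mk₀_id_comp]
  have h2 : r • 𝟙 (ModuleCat.of R (R ⧸ a ^ n)) = 0 := by
    ext
    change r • (1 : R ⧸ a ^ n) = 0
    rw [Algebra.smul_def, mul_one]
    exact Ideal.Quotient.eq_zero_iff_mem.mpr hr
  rw [h1, h2, Abelian.Ext.mk₀_zero, Abelian.Ext.zero_comp, _root_.map_zero]

end LocalCohomologyExactness

section TorsionVanishing

variable {R : Type} [CommRing R]

lemma mk₀_comp_extClass_comp_eq_zero {S₁ S₂ : ShortComplex (ModuleCat.{0} R)}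
    (h₁ : S₁.ShortExact) (h₂ : S₂.ShortExact) (φ : S₁ ⟶ S₂) {T : ModuleCat.{0} R} {i : ℕ}
    (y : Abelian.Ext S₂.X₁ T i) (hy : (Abelian.Ext.mk₀ φ.τ₁).comp y (zero_add i) = 0) :
    (Abelian.Ext.mk₀ φ.τ₃).comp (h₂.extClass.comp y (add_comm 1 i)) (zero_add (i + 1)) = 0 := by
  rw [← Abelian.Ext.comp_assoc _ _ _ (zero_add 1) (add_comm 1 i) (by omega),
    ← ShortComplex.ShortExact.extClass_naturality h₁ h₂ φ,
    Abelian.Ext.comp_assoc _ _ _ (add_zero 1) (zero_add i) (by omega), hy,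
    Abelian.Ext.comp_zero]

variable [IsNoetherianRing R] (a : Ideal R)
variable {T : Type} [AddCommGroup T] [Module R T]

lemma exists_subtype_comp_eq_zero (hT : ∀ r ∈ a, ∀ t : T, r • t = 0) (i : ℕ) :
    ∀ (N : Type) [AddCommGroup N] [Module R N] [Module.Finite R N]
      (x : Abelian.Ext (ModuleCat.of R N) (ModuleCat.of R T) i),
      ∃ k, (Abelian.Ext.mk₀ (ModuleCat.ofHom (a ^ k • ⊤ : Submodule R N).subtype)).comp x
        (zero_add i) = 0 := by
  induction i with
  | zero =>
    intro N _ _ _ x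
    obtain ⟨f, rfl⟩ := Abelian.Ext.homEquiv₀.symm.surjective x
    refine ⟨1, ?_⟩
    rw [Abelian.Ext.homEquiv₀_symm_apply, Abelian.Ext.mk₀_comp_mk₀]
    suffices h : ModuleCat.ofHom (a ^ 1 • ⊤ : Submodule R N).subtype ≫ f = 0 by
      rw [h, Abelian.Ext.mk₀_zero]
    ext ⟨v, hv⟩
    change f.hom v = 0
    have : (a ^ 1 • ⊤ : Submodule R N) ≤ LinearMap.ker f.hom := by
      rw [pow_one]
      refine Submodule.smul_le.mpr fun r hr n _ ↦ ?_
      rw [LinearMap.mem_ker, map_smul]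
      exact hT r hr _
    exact this hv
  | succ i ih =>
    intro N _ _ _ x
    obtain ⟨n, π, hπ⟩ := Module.Finite.exists_fin' R N
    obtain ⟨k₀, hk₀⟩ := a.exists_pow_inf_eq_pow_smul (LinearMap.ker π)
    have h₂ := LinearMap.shortExact_shortComplexKer hπ
    obtain ⟨y, hy⟩ : ∃ y, h₂.extClass.comp y (add_comm 1 i) = x :=
      precomp_extClass_surjective_of_projective_X₂ _ h₂ i x
    obtain ⟨k, hk⟩ := ih (LinearMap.ker π) y
    refine ⟨k₀ + k, ?_⟩
    subst hy
    let G : Submodule R (Fin n → R) := a ^ (k₀ + k) • ⊤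
    have hG : G.map π = a ^ (k₀ + k) • ⊤ := by
      rw [Submodule.map_smul'', Submodule.map_top, LinearMap.range_eq_top.mpr hπ]
    have hGπ : ∀ v ∈ G, π v ∈ (a ^ (k₀ + k) • ⊤ : Submodule R N) := fun v hv ↦
      hG ▸ Submodule.mem_map_of_mem hv
    obtain ⟨π', hπ'⟩ : ∃ π' : G →ₗ[R] (a ^ (k₀ + k) • ⊤ : Submodule R N),
        ∀ v, (π' v : N) = π v := ⟨π.restrict hGπ, fun _ ↦ rfl⟩
    have hsurj : Function.Surjective π' := by
      rintro ⟨w, hw⟩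
      rw [← hG] at hw
      obtain ⟨v, hv, rfl⟩ := hw
      exact ⟨⟨v, hv⟩, Subtype.ext (hπ' _)⟩
    have hker : ∀ v : LinearMap.ker π', π v = 0 := fun v ↦
      (hπ' _).symm.trans (congrArg Subtype.val v.2)
    let j : LinearMap.ker π' →ₗ[R] LinearMap.ker π :=
      (G.subtype ∘ₗ (LinearMap.ker π').subtype).codRestrict _ hker
    have hj : ∀ v, j v ∈ (a ^ k • ⊤ : Submodule R (LinearMap.ker π)) := by
      intro v
      have h1 : ((v : G) : Fin n → R) ∈ a ^ (k₀ + k) • (⊤ : Submodule R (Fin n → R)) ⊓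
        LinearMap.ker π := ⟨v.1.2, hker v⟩
      rw [hk₀ _ (Nat.le_add_right _ _), Nat.add_sub_cancel_left] at h1
      have h2 : ((v : G) : Fin n → R) ∈ a ^ k • LinearMap.ker π :=
        (smul_mono_right (a ^ k) inf_le_right :
          a ^ k • (a ^ k₀ • ⊤ ⊓ LinearMap.ker π) ≤ a ^ k • LinearMap.ker π) h1
      rw [← Submodule.range_subtype (LinearMap.ker π), ← Submodule.map_top,
        ← Submodule.map_smul''] at h2
      obtain ⟨w, hw, hw'⟩ := h2
      have : w = j v := Subtype.ext hw'
      exact this ▸ hw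
    let j₁ : ModuleCat.of R (LinearMap.ker π') ⟶
        ModuleCat.of R (a ^ k • ⊤ : Submodule R (LinearMap.ker π)) :=
      ModuleCat.ofHom (j.codRestrict _ hj)
    let j₂ : ModuleCat.of R (a ^ k • ⊤ : Submodule R (LinearMap.ker π)) ⟶
        ModuleCat.of R (LinearMap.ker π) :=
      ModuleCat.ofHom (Submodule.subtype _)
    let φ : π'.shortComplexKer ⟶ π.shortComplexKer :=
      { τ₁ := j₁ ≫ j₂
        τ₂ := ModuleCat.ofHom G.subtype
        τ₃ := ModuleCat.ofHom (a ^ (k₀ + k) • ⊤ : Submodule R N).subtype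
        comm₁₂ := by ext v; rfl
        comm₂₃ := by ext v; exact (hπ' v).symm }
    refine mk₀_comp_extClass_comp_eq_zero (LinearMap.shortExact_shortComplexKer hsurj) h₂ φ y ?_
    change (Abelian.Ext.mk₀ (j₁ ≫ j₂)).comp y _ = 0
    rw [← Abelian.Ext.mk₀_comp_mk₀_assoc, hk, Abelian.Ext.comp_zero]

lemma TopLC.subsingleton_of_smul_eq_zero (hT : ∀ r ∈ a, ∀ t : T, r • t = 0) (i : ℕ) :
    Subsingleton (TopLC R a (i + 1) T) := by
  refine subsingleton_of_forall_eq 0 fun x ↦ ?_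
  obtain ⟨n, e, rfl⟩ := exists_lcClass_eq a (i + 1) x
  let C : ℕ → ShortComplex (ModuleCat.{0} R) := fun n ↦
    ShortComplex.mk (ModuleCat.ofHom (a ^ n).subtype) (ModuleCat.ofHom (a ^ n).mkQ)
      (by ext x; exact (LinearMap.exact_subtype_mkQ (a ^ n)).apply_apply_eq_zero x)
  have S : ∀ n, (C n).ShortExact := fun n ↦ shortExact_of_exact
    (Submodule.injective_subtype _) (LinearMap.exact_subtype_mkQ _) (Submodule.mkQ_surjective _)
  obtain ⟨y, hy⟩ : ∃ y, (S n).extClass.comp y (add_comm 1 i) = e :=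
    Abelian.Ext.contravariant_sequence_exact₃ (S n) _ e
      (Abelian.Ext.eq_zero_of_projective (P := ModuleCat.of R R) _) (add_comm 1 i)
  obtain ⟨k, hk⟩ := exists_subtype_comp_eq_zero a hT i (a ^ n : Ideal R) y
  rw [lcClass_eq_zero_iff]
  refine ⟨n + k, Nat.le_add_right _ _, ?_⟩
  subst hy
  have hle : a ^ (n + k) ≤ a ^ n := Ideal.pow_le_pow_right (Nat.le_add_right _ _)
  have hj : ∀ v, Submodule.inclusion hle v ∈ (a ^ k • ⊤ : Submodule R (a ^ n : Ideal R)) := by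
    rintro ⟨v, hv⟩
    have h2 := hv
    rw [add_comm, pow_add, ← smul_eq_mul, ← Submodule.range_subtype (a ^ n),
      ← Submodule.map_top, ← Submodule.map_smul''] at h2
    obtain ⟨w, hw, hw'⟩ := h2
    have : w = Submodule.inclusion hle ⟨v, hv⟩ := Subtype.ext hw'
    exact this ▸ hw
  let φ : C (n + k) ⟶ C n :=
    { τ₁ := ModuleCat.ofHom (Submodule.inclusion hle)
      τ₂ := 𝟙 _
      τ₃ := powProj a (Nat.le_add_right n k)
      comm₁₂ := rfl
      comm₂₃ := rfl }
  refine mk₀_comp_extClass_comp_eq_zero (S (n + k)) (S n) φ y ?_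
  let j' : (a ^ (n + k) : Ideal R) →ₗ[R] (a ^ k • ⊤ : Submodule R (a ^ n : Ideal R)) :=
    (Submodule.inclusion hle).codRestrict _ hj
  have : φ.τ₁ = ModuleCat.ofHom j' ≫
    ModuleCat.ofHom (a ^ k • ⊤ : Submodule R (a ^ n : Ideal R)).subtype := rfl
  rw [this, ← Abelian.Ext.mk₀_comp_mk₀_assoc, hk, Abelian.Ext.comp_zero]

end TorsionVanishing

section DegreeZero

variable {R : Type} [CommRing R] {a m : Ideal R}

/-- The canonical map `R / a ^ (n + 1) → R / m` for `a ≤ m`. -/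
noncomputable def powToQuot (h : a ≤ m) (n : ℕ) :
    ModuleCat.of R (R ⧸ a ^ (n + 1)) ⟶ ModuleCat.of R (R ⧸ m) :=
  ModuleCat.ofHom (Submodule.mapQ _ _ LinearMap.id
    ((Ideal.pow_le_self n.succ_ne_zero).trans h))

lemma lcClass_powToQuot (h : a ≤ m) (n : ℕ) :
    lcClass a 0 (n + 1) (R ⧸ m) (Abelian.Ext.mk₀ (powToQuot h n)) =
      lcClass a 0 1 (R ⧸ m) (Abelian.Ext.mk₀ (powToQuot h 0)) := by
  rw [← lcClass_precomp a 0 (Nat.le_add_left 1 n), Abelian.Ext.mk₀_comp_mk₀]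
  congr 2
  ext
  rfl

lemma TopLC.zero_quotient_span (h : a ≤ m) (x : TopLC R a 0 (R ⧸ m)) :
    ∃ c : R, x = c • lcClass a 0 1 (R ⧸ m) (Abelian.Ext.mk₀ (powToQuot h 0)) := by
  obtain ⟨n, e, rfl⟩ := exists_lcClass_eq a 0 x
  obtain ⟨f, rfl⟩ := Abelian.Ext.homEquiv₀.symm.surjective e
  rw [Abelian.Ext.homEquiv₀_symm_apply, ← lcClass_precomp a 0 n.le_succ,
    Abelian.Ext.mk₀_comp_mk₀]
  obtain ⟨c, hc⟩ := Submodule.Quotient.mk_surjective _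
    ((powProj a n.le_succ ≫ f).hom (Submodule.Quotient.mk 1))
  refine ⟨c, ?_⟩
  rw [← lcClass_powToQuot h n, ← _root_.map_smul, ← Abelian.Ext.mk₀_smul]
  congr 2
  ext
  refine hc.symm.trans ?_
  change _ = c • (Submodule.Quotient.mk 1 : R ⧸ m)
  rw [← Submodule.Quotient.mk_smul, smul_eq_mul, mul_one]

lemma TopLC.zero_quotient_nontrivial (h : a ≤ m) (hm : m ≠ ⊤) :
    Nontrivial (TopLC R a 0 (R ⧸ m)) := by
  refine ⟨lcClass a 0 1 (R ⧸ m) (Abelian.Ext.mk₀ (powToQuot h 0)), 0, fun h0 ↦ ?_⟩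
  rw [lcClass_eq_zero_iff] at h0
  obtain ⟨n, hn, h0⟩ := h0
  rw [Abelian.Ext.mk₀_comp_mk₀, Abelian.Ext.mk₀_eq_zero_iff] at h0
  have := congrArg (fun φ ↦ φ.hom (Submodule.Quotient.mk 1)) h0
  change (Submodule.Quotient.mk 1 : R ⧸ m) = 0 at this
  rw [Submodule.Quotient.mk_eq_zero] at this
  exact hm ((Ideal.eq_top_iff_one m).mpr this)

lemma TopLC.zero_quotient_isArtinian (h : a ≤ m) [hm : m.IsMaximal] :
    IsArtinian R (TopLC R a 0 (R ⧸ m)) := by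
  let x := lcClass a 0 1 (R ⧸ m) (Abelian.Ext.mk₀ (powToQuot h 0))
  have hx : ∀ r ∈ m, r • x = 0 := by
    intro r hr
    have h1 : r • (LinearMap.id : R ⧸ m →ₗ[R] R ⧸ m) = 0 := by
      ext
      change r • (1 : R ⧸ m) = 0
      rw [Algebra.smul_def, mul_one]
      exact Ideal.Quotient.eq_zero_iff_mem.mpr hr
    have h2 := TopLC.map_smul a 0 r (LinearMap.id : R ⧸ m →ₗ[R] R ⧸ m)
    rw [h1, TopLC.map_zero, TopLC.map_id] at h2
    exact (LinearMap.congr_fun h2 x).symm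
  have : IsSimpleModule R (R ⧸ m) := isSimpleModule_iff_isCoatom.mpr hm.out
  refine isArtinian_of_surjective (R ⧸ m)
    (Submodule.liftQ m (LinearMap.toSpanSingleton R _ x) fun r hr ↦ hx r hr) fun y ↦ ?_
  obtain ⟨c, rfl⟩ := TopLC.zero_quotient_span h y
  exact ⟨Submodule.Quotient.mk c, rfl⟩

end DegreeZero

section DimensionBound

variable {R : Type} [CommRing R]

/-- Every prime in the support of `M` has coheight less than `i`. -/
def SuppLT (R : Type) [CommRing R] (M : Type) [AddCommGroup M] [Module R M] (i : ℕ) : Prop :=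
  ∀ p ∈ Module.support R M, Order.coheight p < (i : ℕ∞)

variable {L M N : Type} [AddCommGroup L] [Module R L] [AddCommGroup M] [Module R M]
  [AddCommGroup N] [Module R N]

lemma SuppLT.of_injective {i : ℕ} (h : SuppLT R N i) (f : M →ₗ[R] N)
    (hf : Function.Injective f) : SuppLT R M i :=
  fun p hp ↦ h p (Module.support_subset_of_injective f hf hp)

lemma SuppLT.of_surjective {i : ℕ} (h : SuppLT R M i) (f : M →ₗ[R] N)
    (hf : Function.Surjective f) : SuppLT R N i :=
  fun p hp ↦ h p (Module.support_subset_of_surjective f hf hp)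

lemma mem_support_quotient {p : Ideal R} {q : PrimeSpectrum R} :
    q ∈ Module.support R (R ⧸ p) ↔ p ≤ q.asIdeal := by
  rw [Module.support_eq_zeroLocus, Ideal.annihilator_quotient, PrimeSpectrum.mem_zeroLocus]
  rfl

lemma coheight_lt_of_lt {p q : PrimeSpectrum R} (h : p < q) {i : ℕ}
    (hp : Order.coheight p < ((i + 1 : ℕ) : ℕ∞)) : Order.coheight q < (i : ℕ∞) := by
  have := (Order.coheight_add_one_le h).trans_lt hp
  push_cast at this
  exact lt_of_add_lt_add_right this

lemma suppLT_quotient {p : PrimeSpectrum R} {i : ℕ} (hp : Order.coheight p < (i : ℕ∞)) :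
    SuppLT R (R ⧸ p.asIdeal) i :=
  fun q hq ↦ (Order.coheight_anti (show p ≤ q from mem_support_quotient.mp hq)).trans_lt hp

open scoped Pointwise in
lemma SuppLT.quotSMulTop [Module.Finite R M] {i : ℕ} (h : SuppLT R M (i + 1)) {r : R}
    (hr : ∀ p ∈ Module.support R M, Order.coheight p = (i : ℕ∞) → r ∉ p.asIdeal) :
    SuppLT R (QuotSMulTop r M) i := by
  intro p hp
  rw [Module.support_quotSMulTop] at hp
  have h1 := h p hp.1
  push_cast at h1
  refine lt_of_le_of_ne (Order.le_of_lt_add_one h1) fun h2 ↦ hr p hp.1 h2 ?_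
  exact hp.2 rfl

lemma SuppLT.quotSMulTop_quotient {p : PrimeSpectrum R} {i : ℕ}
    (hp : Order.coheight p < ((i + 1 : ℕ) : ℕ∞)) {r : R} (hr : r ∉ p.asIdeal) :
    SuppLT R (QuotSMulTop r (R ⧸ p.asIdeal)) i := by
  refine (suppLT_quotient hp).quotSMulTop fun q hq hqi hrq ↦ ?_
  have hlt : p < q := lt_of_le_of_ne (mem_support_quotient.mp hq)
    fun h ↦ hr (h ▸ hrq)
  exact (coheight_lt_of_lt hlt hp).ne hqi

lemma smul_injective_quotient {p : Ideal R} [p.IsPrime] {r : R} (hr : r ∉ p) :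
    Function.Injective (LinearMap.lsmul R (R ⧸ p) r) := by
  rw [injective_iff_map_eq_zero]
  intro x hx
  obtain ⟨x, rfl⟩ := Ideal.Quotient.mk_surjective x
  have : (Ideal.Quotient.mk p) (r * x) = 0 := by
    rw [_root_.map_mul]; exact hx
  rw [Ideal.Quotient.eq_zero_iff_mem] at this ⊢
  exact (Ideal.IsPrime.mem_or_mem ‹_› this).resolve_left hr

open scoped Pointwise in
lemma exact_lsmul_quotSMulTop (r : R) :
    Function.Exact (LinearMap.lsmul R M r) (Submodule.mkQ (r • (⊤ : Submodule R M))) := by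
  intro x
  rw [← LinearMap.mem_ker, Submodule.ker_mkQ]
  constructor
  · rintro ⟨y, -, rfl⟩; exact ⟨y, rfl⟩
  · rintro ⟨y, rfl⟩; exact ⟨y, trivial, rfl⟩

open scoped Pointwise in
lemma SuppLT.coker {p : PrimeSpectrum R} {i : ℕ} (hp : Order.coheight p < ((i + 1 : ℕ) : ℕ∞))
    {f : M →ₗ[R] R ⧸ p.asIdeal} (hf : f ≠ 0) :
    SuppLT R ((R ⧸ p.asIdeal) ⧸ LinearMap.range f) i := by
  obtain ⟨x, hx⟩ := DFunLike.ne_iff.mp hf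
  obtain ⟨r, hr⟩ := Ideal.Quotient.mk_surjective (f x)
  have hrp : r ∉ p.asIdeal := fun h ↦ hx (hr.symm.trans (Ideal.Quotient.eq_zero_iff_mem.mpr h))
  have hle : r • (⊤ : Submodule R (R ⧸ p.asIdeal)) ≤ LinearMap.range f := by
    rintro _ ⟨s, -, rfl⟩
    obtain ⟨s, rfl⟩ := Ideal.Quotient.mk_surjective s
    refine ⟨s • x, ?_⟩
    rw [_root_.map_smul, ← hr]
    change Ideal.Quotient.mk p.asIdeal (s * r) = Ideal.Quotient.mk p.asIdeal (r * s)
    rw [mul_comm]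
  exact (SuppLT.quotSMulTop_quotient hp hrp).of_surjective (Submodule.factor hle)
    (Submodule.factor_surjective hle)

end DimensionBound

section Vanishing

variable {R : Type} [CommRing R] (a : Ideal R)
variable {L M N : Type} [AddCommGroup L] [Module R L] [AddCommGroup M] [Module R M]
  [AddCommGroup N] [Module R N]

lemma TopLC.map_lsmul (i : ℕ) (r : R) :
    TopLC.map a i (LinearMap.lsmul R M r) = LinearMap.lsmul R (TopLC R a i M) r := by
  have : LinearMap.lsmul R M r = r • LinearMap.id := by ext; rfl
  rw [this, TopLC.map_smul, TopLC.map_id]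
  ext
  rfl

variable {a} in
lemma TopLC.subsingleton_of_smul_injective {i : ℕ} {r : R} (hr : r ∈ a)
    (h : ∀ x : TopLC R a i M, r • x = 0 → x = 0) : Subsingleton (TopLC R a i M) := by
  refine subsingleton_of_forall_eq 0 fun x ↦ ?_
  obtain ⟨n, hn⟩ := TopLC.exists_pow_smul_eq_zero a i x
  have h1 := hn _ (Ideal.pow_mem_pow hr n)
  clear hn
  induction n with
  | zero => simpa using h1
  | succ n ih => exact ih (h _ (by rwa [smul_smul, ← pow_succ']))

lemma TopLC.subsingleton_of_exact (i : ℕ) {f : L →ₗ[R] M} {g : M →ₗ[R] N}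
    (hf : Function.Injective f) (hfg : Function.Exact f g) (hg : Function.Surjective g)
    [Subsingleton (TopLC R a i L)] [Subsingleton (TopLC R a i N)] :
    Subsingleton (TopLC R a i M) := by
  refine subsingleton_of_forall_eq 0 fun x ↦ ?_
  obtain ⟨y, rfl⟩ := (TopLC.exact_map a i hf hfg hg x).mp (Subsingleton.elim _ _)
  rw [Subsingleton.elim y 0, _root_.map_zero]

lemma TopLC.subsingleton_of_linearEquiv (i : ℕ) (e : M ≃ₗ[R] N)
    [Subsingleton (TopLC R a i N)] : Subsingleton (TopLC R a i M) := by
  refine subsingleton_of_forall_eq 0 fun x ↦ ?_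
  have : x = TopLC.map a i e.symm.toLinearMap (TopLC.map a i e.toLinearMap x) := by
    rw [← LinearMap.comp_apply, ← TopLC.map_comp, LinearEquiv.symm_comp, TopLC.map_id]; rfl
  rw [this, Subsingleton.elim (TopLC.map a i e.toLinearMap x) 0, _root_.map_zero]

lemma TopLC.subsingleton_of_subsingleton (i : ℕ) [Subsingleton M] :
    Subsingleton (TopLC R a i M) := by
  refine subsingleton_of_forall_eq 0 fun x ↦ ?_
  have : (LinearMap.id : M →ₗ[R] M) = 0 := Subsingleton.elim _ _
  have h := LinearMap.congr_fun (TopLC.map_id (M := M) a i) x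
  rw [this, TopLC.map_zero] at h
  exact h.symm

variable {a}

lemma TopLC.subsingleton_quotient_of_le [IsNoetherianRing R] {p : Ideal R} (h : a ≤ p) (i : ℕ) :
    Subsingleton (TopLC R a (i + 1) (R ⧸ p)) := by
  refine TopLC.subsingleton_of_smul_eq_zero a (fun r hr t ↦ ?_) i
  obtain ⟨t, rfl⟩ := Ideal.Quotient.mk_surjective t
  have h1 : r • (Ideal.Quotient.mk p) t = Ideal.Quotient.mk p (r * t) := rfl
  rw [h1, Ideal.Quotient.eq_zero_iff_mem]
  exact p.mul_mem_right _ (h hr)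

lemma TopLC.subsingleton_of_suppLT [IsNoetherianRing R]
    (hmx : ∀ p : Ideal R, p.IsPrime → (a ≤ p ↔ p.IsMaximal)) (i : ℕ) :
    ∀ (M : Type) [AddCommGroup M] [Module R M] [Module.Finite R M],
      SuppLT R M i → Subsingleton (TopLC R a i M) := by
  induction i with
  | zero =>
    intro M _ _ _ h
    have : Subsingleton M := by
      rw [← Module.support_eq_empty_iff (R := R), Set.eq_empty_iff_forall_notMem]
      exact fun p hp ↦ by simpa using h p hp
    exact TopLC.subsingleton_of_subsingleton a 0
  | succ i ih =>
    intro M _ _ hM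
    refine IsNoetherianRing.induction_on_isQuotientEquivQuotientPrime R hM
      (motive := fun N _ _ _ ↦ SuppLT R N (i + 1) → Subsingleton (TopLC R a (i + 1) N))
      ?_ ?_ ?_
    · intro N _ _ _ _ _
      exact TopLC.subsingleton_of_subsingleton a _
    · intro N _ _ _ p e hN
      have hp : Order.coheight p < ((i + 1 : ℕ) : ℕ∞) :=
        (hN.of_injective e.symm.toLinearMap e.symm.injective) p
          (mem_support_quotient.mpr le_rfl)
      suffices Subsingleton (TopLC R a (i + 1) (R ⧸ p.asIdeal)) from
        TopLC.subsingleton_of_linearEquiv a _ e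
      by_cases hpm : p.asIdeal.IsMaximal
      · exact TopLC.subsingleton_quotient_of_le ((hmx _ p.isPrime).mpr hpm) i
      · rw [← hmx _ p.isPrime, SetLike.not_le_iff_exists] at hpm
        obtain ⟨r, hra, hrp⟩ := hpm
        have hQ := ih _ (SuppLT.quotSMulTop_quotient hp hrp)
        obtain ⟨δ, hδ₁, hδ₂⟩ := TopLC.exists_connecting a i (smul_injective_quotient hrp)
          (exact_lsmul_quotSMulTop r) (Submodule.mkQ_surjective _)
        refine TopLC.subsingleton_of_smul_injective hra fun x hx ↦ ?_
        rw [TopLC.map_lsmul] at hδ₂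
        obtain ⟨y, rfl⟩ := (hδ₂ x).mp hx
        have : y = 0 := hQ.elim _ _
        rw [this, _root_.map_zero]
    · intro N₁ _ _ _ N₂ _ _ _ N₃ _ _ _ f g hf hg hfg h₁ h₃ h₂
      have := h₁ (h₂.of_injective f hf)
      have := h₃ (h₂.of_surjective g hg)
      exact TopLC.subsingleton_of_exact a _ hf hfg hg

lemma TopLC.map_surjective_of_subsingleton (d : ℕ) (f : M →ₗ[R] N)
    (h1 : Subsingleton (TopLC R a (d + 1) (LinearMap.ker f)))
    (h2 : Subsingleton (TopLC R a d (N ⧸ LinearMap.range f))) :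
    Function.Surjective (TopLC.map a d f) := by
  have hfr : f = (LinearMap.range f).subtype ∘ₗ f.rangeRestrict := by ext; rfl
  intro x
  obtain ⟨y, rfl⟩ := (TopLC.exact_map a d (Submodule.injective_subtype _)
    (LinearMap.exact_subtype_mkQ (LinearMap.range f)) (Submodule.mkQ_surjective _) x).mp
    (h2.elim _ _)
  obtain ⟨δ, hδ₁, -⟩ := TopLC.exists_connecting a d (f := (LinearMap.ker f).subtype)
    (g := f.rangeRestrict) (Submodule.injective_subtype _)
    (LinearMap.exact_iff.mpr (by rw [LinearMap.ker_rangeRestrict, Submodule.range_subtype]))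
    f.surjective_rangeRestrict
  obtain ⟨z, rfl⟩ := (hδ₁ y).mp (h1.elim _ _)
  refine ⟨z, ?_⟩
  rw [hfr, TopLC.map_comp]
  rfl

/-- If the cokernel has small support, a map induces a surjection on top local cohomology. -/
lemma TopLC.map_surjective [IsNoetherianRing R]
    (hmx : ∀ p : Ideal R, p.IsPrime → (a ≤ p ↔ p.IsMaximal)) (d : ℕ)
    [Module.Finite R M] [Module.Finite R N] (f : M →ₗ[R] N) (hM : SuppLT R M (d + 1))
    (hN : SuppLT R (N ⧸ LinearMap.range f) d) : Function.Surjective (TopLC.map a d f) :=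
  TopLC.map_surjective_of_subsingleton d f
    (TopLC.subsingleton_of_suppLT hmx _ _ (hM.of_injective _ (Submodule.injective_subtype _)))
    (TopLC.subsingleton_of_suppLT hmx _ _ hN)

end Vanishing

section Melkersson

variable {R : Type} [CommRing R] {H : Type} [AddCommGroup H] [Module R H]

/-- Melkersson's criterion: an `r`-power torsion module with Artinian `r`-torsion is Artinian. -/
lemma isArtinian_of_ker_lsmul (r : R) (htors : ∀ x : H, ∃ n : ℕ, r ^ n • x = 0)
    [IsArtinian R (LinearMap.ker (LinearMap.lsmul R H r))] : IsArtinian R H := by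
  rw [← monotone_stabilizes_iff_artinian]
  intro f
  let N : ℕ → Submodule R H := fun k ↦ OrderDual.ofDual (f k)
  have hN : ∀ {k l}, k ≤ l → N l ≤ N k := fun h ↦ f.monotone h
  let F : ℕ → ℕ → Submodule R (LinearMap.ker (LinearMap.lsmul R H r)) := fun k n ↦
    ((N k).map (LinearMap.lsmul R H (r ^ n))).comap (Submodule.subtype _)
  have hF : ∀ {k l n n'}, k ≤ l → n ≤ n' → F l n' ≤ F k n := by
    rintro k l n n' hkl hn x ⟨y, hy, hyx⟩
    refine ⟨r ^ (n' - n) • y, (N k).smul_mem _ (hN hkl hy), ?_⟩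
    rw [← hyx, LinearMap.lsmul_apply, LinearMap.lsmul_apply, smul_smul, ← pow_add,
      Nat.add_sub_cancel' hn]
  obtain ⟨n₀, hn₀⟩ := IsArtinian.monotone_stabilizes
    (⟨fun k ↦ OrderDual.toDual (F k k), fun k l h ↦ hF h h⟩ : ℕ →o (Submodule R _)ᵒᵈ)
  have hn₀' : ∀ k, n₀ ≤ k → F n₀ n₀ = F k k := hn₀
  have hst : ∀ n, ∃ k₀, ∀ k, k₀ ≤ k → F k₀ n = F k n := fun n ↦
    IsArtinian.monotone_stabilizes
      (⟨fun k ↦ OrderDual.toDual (F k n), fun k l h ↦ hF h le_rfl⟩ : ℕ →o (Submodule R _)ᵒᵈ)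
  choose κ hκ using hst
  let k₀ := n₀ + ∑ n ∈ Finset.range n₀, κ n
  have key : ∀ k, k₀ ≤ k → ∀ n, F k₀ n ≤ F k n := by
    intro k hk n
    by_cases hn : n < n₀
    · have h1 : κ n ≤ k₀ := (Finset.single_le_sum (f := κ) (fun _ _ ↦ Nat.zero_le _)
        (Finset.mem_range.mpr hn)).trans (Nat.le_add_left _ _)
      rw [← hκ n k (h1.trans hk)]
      exact hF h1 le_rfl
    · have h2 : n₀ ≤ k := (Nat.le_add_right _ _).trans hk
      calc F k₀ n ≤ F n₀ n₀ := hF (Nat.le_add_right _ _) (not_lt.mp hn)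
        _ = F (max k n) (max k n) := hn₀' _ (h2.trans (le_max_left _ _))
        _ ≤ F k n := hF (le_max_left _ _) (le_max_right _ _)
  refine ⟨k₀, fun k hk ↦ ?_⟩
  suffices h : N k₀ ≤ N k from le_antisymm (α := Submodule R H) h (hN hk)
  have hind : ∀ j : ℕ, ∀ x ∈ N k₀, r ^ j • x = 0 → x ∈ N k := by
    intro j
    induction j with
    | zero =>
      intro x _ hx
      rw [pow_zero, one_smul] at hx
      exact hx ▸ (N k).zero_mem
    | succ j ih =>
      intro x hx hxj
      obtain ⟨l, hl, hlx⟩ := key k hk j (x := ⟨r ^ j • x, by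
        rw [LinearMap.mem_ker, LinearMap.lsmul_apply, smul_smul, ← pow_succ', hxj]⟩) ⟨x, hx, rfl⟩
      have h3 : r ^ j • l = r ^ j • x := hlx
      have := ih (x - l) ((N k₀).sub_mem hx (hN hk hl)) (by rw [smul_sub, h3, sub_self])
      simpa using (N k).add_mem this hl
  intro x hx
  obtain ⟨j, hj⟩ := htors x
  exact hind j x hx hj

end Melkersson

section Artinian

variable {R : Type} [CommRing R] {a : Ideal R}
variable {L M N : Type} [AddCommGroup L] [Module R L] [AddCommGroup M] [Module R M]
  [AddCommGroup N] [Module R N]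

lemma TopLC.pow_smul_eq_zero {i : ℕ} {r : R} (hr : r ∈ a) (x : TopLC R a i M) :
    ∃ n : ℕ, r ^ n • x = 0 := by
  obtain ⟨n, hn⟩ := TopLC.exists_pow_smul_eq_zero a i x
  exact ⟨n, hn _ (Ideal.pow_mem_pow hr n)⟩

lemma TopLC.zero_quotient_subsingleton {p : Ideal R} [p.IsPrime] (h : ¬ a ≤ p) :
    Subsingleton (TopLC R a 0 (R ⧸ p)) := by
  obtain ⟨r, hra, hrp⟩ := SetLike.not_le_iff_exists.mp h
  refine TopLC.subsingleton_of_smul_injective hra fun x hx ↦ ?_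
  refine TopLC.map_injective_zero a (smul_injective_quotient hrp) ?_
  rw [TopLC.map_lsmul, _root_.map_zero]
  exact hx

lemma TopLC.isArtinian_of_exact (i : ℕ) {f : L →ₗ[R] M} {g : M →ₗ[R] N}
    (hf : Function.Injective f) (hfg : Function.Exact f g) (hg : Function.Surjective g)
    [IsArtinian R (TopLC R a i L)] [IsArtinian R (TopLC R a i N)] :
    IsArtinian R (TopLC R a i M) :=
  isArtinian_of_range_eq_ker (TopLC.map a i f) (TopLC.map a i g)
    (LinearMap.exact_iff.mp (TopLC.exact_map a i hf hfg hg)).symm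

lemma TopLC.isArtinian_of_linearEquiv (i : ℕ) (e : M ≃ₗ[R] N)
    [IsArtinian R (TopLC R a i N)] : IsArtinian R (TopLC R a i M) := by
  refine isArtinian_of_surjective _ (TopLC.map a i e.symm.toLinearMap) fun x ↦
    ⟨TopLC.map a i e.toLinearMap x, ?_⟩
  rw [← LinearMap.comp_apply, ← TopLC.map_comp, LinearEquiv.symm_comp, TopLC.map_id]
  rfl

lemma TopLC.isArtinian [IsNoetherianRing R]
    (hmx : ∀ p : Ideal R, p.IsPrime → (a ≤ p ↔ p.IsMaximal)) (i : ℕ) :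
    ∀ (M : Type) [AddCommGroup M] [Module R M] [Module.Finite R M],
      IsArtinian R (TopLC R a i M) := by
  induction i with
  | zero =>
    intro M _ _ hM
    refine IsNoetherianRing.induction_on_isQuotientEquivQuotientPrime R hM
      (motive := fun N _ _ _ ↦ IsArtinian R (TopLC R a 0 N)) ?_ ?_ ?_
    · intro N _ _ _ _
      have := TopLC.subsingleton_of_subsingleton (M := N) a 0
      infer_instance
    · intro N _ _ _ p e
      suffices IsArtinian R (TopLC R a 0 (R ⧸ p.asIdeal)) from
        TopLC.isArtinian_of_linearEquiv _ e
      by_cases hpm : a ≤ p.asIdeal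
      · have := (hmx _ p.isPrime).mp hpm
        exact TopLC.zero_quotient_isArtinian hpm
      · have := TopLC.zero_quotient_subsingleton hpm
        infer_instance
    · intro N₁ _ _ _ N₂ _ _ _ N₃ _ _ _ f g hf hg hfg h₁ h₃
      exact TopLC.isArtinian_of_exact _ hf hfg hg
  | succ i ih =>
    intro M _ _ hM
    refine IsNoetherianRing.induction_on_isQuotientEquivQuotientPrime R hM
      (motive := fun N _ _ _ ↦ IsArtinian R (TopLC R a (i + 1) N)) ?_ ?_ ?_
    · intro N _ _ _ _
      have := TopLC.subsingleton_of_subsingleton (M := N) a (i + 1)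
      infer_instance
    · intro N _ _ _ p e
      suffices IsArtinian R (TopLC R a (i + 1) (R ⧸ p.asIdeal)) from
        TopLC.isArtinian_of_linearEquiv _ e
      by_cases hpm : a ≤ p.asIdeal
      · have := TopLC.subsingleton_quotient_of_le hpm i
        infer_instance
      · obtain ⟨r, hra, hrp⟩ := SetLike.not_le_iff_exists.mp hpm
        have := ih (QuotSMulTop r (R ⧸ p.asIdeal))
        obtain ⟨δ, -, hδ⟩ := TopLC.exists_connecting a i (smul_injective_quotient hrp)
          (exact_lsmul_quotSMulTop r) (Submodule.mkQ_surjective _)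
        rw [TopLC.map_lsmul, LinearMap.exact_iff] at hδ
        have h2 : IsArtinian R (LinearMap.ker (LinearMap.lsmul R
            (TopLC R a (i + 1) (R ⧸ p.asIdeal)) r)) := by
          rw [hδ]
          exact isArtinian_of_surjective _ δ.rangeRestrict δ.surjective_rangeRestrict
        exact isArtinian_of_ker_lsmul r (TopLC.pow_smul_eq_zero hra)
    · intro N₁ _ _ _ N₂ _ _ _ N₃ _ _ _ f g hf hg hfg h₁ h₃
      exact TopLC.isArtinian_of_exact _ hf hfg hg

end Artinian

section NonvanishingQuotient

variable {R : Type} [CommRing R]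

/-- By Krull's height theorem, a prime minimal over `p` and one more element is not the top of
a chain of primes `p < p₁ < p₂`. -/
lemma not_mem_minimalPrimes_of_lt_of_lt [IsNoetherianRing R] {p p₁ p₂ : PrimeSpectrum R}
    (h₁ : p < p₁) (h₂ : p₁ < p₂) (y : R) :
    p₂.asIdeal ∉ (p.asIdeal ⊔ Ideal.span {y}).minimalPrimes := by
  intro hy
  have hle := Ideal.map_height_le_one_of_mem_minimalPrimes hy
  have hP : ∀ q : PrimeSpectrum R, p ≤ q →
      (q.asIdeal.map (Ideal.Quotient.mk p.asIdeal)).IsPrime := fun q hq ↦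
    Ideal.map_isPrime_of_surjective Ideal.Quotient.mk_surjective (by rwa [Ideal.mk_ker])
  let e : ∀ q : PrimeSpectrum R, p ≤ q → PrimeSpectrum (R ⧸ p.asIdeal) := fun q hq ↦ ⟨_, hP q hq⟩
  have he : ∀ q q' hq hq', q < q' → e q hq < e q' hq' := by
    intro q q' hq hq' h
    refine lt_of_le_not_ge (Ideal.map_mono h.le) fun h' ↦ h.not_ge ?_
    have := Ideal.comap_mono (f := Ideal.Quotient.mk p.asIdeal)
      (show Ideal.map _ q'.asIdeal ≤ Ideal.map _ q.asIdeal from h')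
    rwa [Ideal.comap_map_mk hq, Ideal.comap_map_mk hq'] at this
  have e1 := Order.height_add_one_le (he _ _ le_rfl h₁.le h₁)
  have e2 := Order.height_add_one_le (he _ _ h₁.le (h₁.trans h₂).le h₂)
  rw [show Ideal.map (Ideal.Quotient.mk p.asIdeal) p₂.asIdeal =
    (e p₂ (h₁.trans h₂).le).asIdeal from rfl, PrimeSpectrum.height_eq_orderHeight] at hle
  have h3 : (2 : ℕ∞) ≤ 1 := calc
    (2 : ℕ∞) = 0 + 1 + 1 := rfl
    _ ≤ _ := (by gcongr; exact (add_le_add zero_le le_rfl).trans e1)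
    _ ≤ _ := e2
    _ ≤ 1 := hle
  exact absurd h3 (by decide)

/-- There are infinitely many primes between `p` and a prime two steps above it. -/
lemma exists_coheight_eq_of_finset [IsNoetherianRing R] {p : PrimeSpectrum R} {d : ℕ}
    (hp : Order.coheight p = ((d + 2 : ℕ) : ℕ∞)) (S : Finset (PrimeSpectrum R))
    (hS : ∀ q ∈ S, Order.coheight q = ((d + 1 : ℕ) : ℕ∞)) :
    ∃ q, p < q ∧ Order.coheight q = ((d + 1 : ℕ) : ℕ∞) ∧ q ∉ S := by
  classical
  obtain ⟨-, ⟨p₁, h₁, hp₁⟩, hp'⟩ := Order.coheight_eq_coe_add_one_iff.mp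
    (show Order.coheight p = ((d + 1 : ℕ) : ℕ∞) + 1 by rw [hp]; push_cast; rfl)
  obtain ⟨-, ⟨p₂, h₂, hp₂⟩, -⟩ := Order.coheight_eq_coe_add_one_iff.mp
    (show Order.coheight p₁ = (d : ℕ∞) + 1 by rw [hp₁]; push_cast; rfl)
  have havoid : ¬ ((p₂.asIdeal : Set R) ⊆
      ⋃ i ∈ (↑(insert p S) : Set (PrimeSpectrum R)), (i.asIdeal : Set R)) := by
    rw [Ideal.subset_union_prime p p (fun i _ _ _ ↦ i.isPrime)]
    rintro ⟨i, hi, hle⟩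
    rcases Finset.mem_insert.mp hi with rfl | hi
    · exact (h₁.trans h₂).not_ge hle
    · have := Order.coheight_anti (show p₂ ≤ i from hle)
      rw [hS i hi, hp₂] at this
      exact absurd (by exact_mod_cast this) (Nat.not_succ_le_self d)
  obtain ⟨y, hy, hyS⟩ := Set.not_subset.mp havoid
  simp only [Set.mem_iUnion, not_exists] at hyS
  have hle : p.asIdeal ⊔ Ideal.span {y} ≤ p₂.asIdeal :=
    sup_le (h₁.trans h₂).le ((Ideal.span_singleton_le_iff_mem _).mpr hy)
  obtain ⟨q, hq, hqp⟩ := Ideal.exists_minimalPrimes_le hle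
  let q' : PrimeSpectrum R := ⟨q, hq.1.1⟩
  have hyq : y ∈ q := hq.1.2 (le_sup_right (a := p.asIdeal) (Ideal.mem_span_singleton_self y))
  have hpq : p < q' := lt_of_le_of_ne (le_sup_left.trans hq.1.2) fun h ↦
    hyS p (Finset.mem_coe.mpr (Finset.mem_insert_self _ _)) (h ▸ hyq)
  have hqp₂ : q' < p₂ := lt_of_le_of_ne hqp fun h ↦
    not_mem_minimalPrimes_of_lt_of_lt h₁ h₂ y (h ▸ hq)
  refine ⟨q', hpq, le_antisymm (hp' _ hpq) ?_, fun h ↦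
    hyS q' (Finset.mem_coe.mpr (Finset.mem_insert_of_mem h)) hyq⟩
  have := Order.coheight_add_one_le hqp₂
  rw [hp₂] at this
  exact_mod_cast this

variable {a : Ideal R}

lemma TopLC.subsingleton_of_support_le [IsNoetherianRing R]
    (hmx : ∀ p : Ideal R, p.IsPrime → (a ≤ p ↔ p.IsMaximal)) {d : ℕ} {p : PrimeSpectrum R}
    (hp : Order.coheight p = (d : ℕ∞)) (h : Subsingleton (TopLC R a d (R ⧸ p.asIdeal)))
    (M : Type) [AddCommGroup M] [Module R M] [hM : Module.Finite R M]
    (hs : ∀ q ∈ Module.support R M, p ≤ q) : Subsingleton (TopLC R a d M) := by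
  revert hs
  refine IsNoetherianRing.induction_on_isQuotientEquivQuotientPrime R hM
    (motive := fun N _ _ _ ↦ (∀ q ∈ Module.support R N, p ≤ q) → Subsingleton (TopLC R a d N))
    ?_ ?_ ?_
  · intro N _ _ _ _ _
    exact TopLC.subsingleton_of_subsingleton a _
  · intro N _ _ _ q e hN
    suffices Subsingleton (TopLC R a d (R ⧸ q.asIdeal)) from
      TopLC.subsingleton_of_linearEquiv a _ e
    have hpq : p ≤ q := hN q (by
      rw [e.support_eq]; exact mem_support_quotient.mpr le_rfl)
    rcases hpq.eq_or_lt with rfl | hlt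
    · exact h
    · refine TopLC.subsingleton_of_suppLT hmx _ _ (suppLT_quotient (coheight_lt_of_lt hlt ?_))
      rw [hp]
      exact_mod_cast Nat.lt_succ_self d
  · intro N₁ _ _ _ N₂ _ _ _ N₃ _ _ _ f g hf hg hfg h₁ h₃ h₂
    have := h₁ fun q hq ↦ h₂ q (Module.support_subset_of_injective f hf hq)
    have := h₃ fun q hq ↦ h₂ q (Module.support_subset_of_surjective g hg hq)
    exact TopLC.subsingleton_of_exact a _ hf hfg hg

lemma TopLC.quotient_nontrivial [IsNoetherianRing R]
    (hmx : ∀ p : Ideal R, p.IsPrime → (a ≤ p ↔ p.IsMaximal)) (d : ℕ) :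
    ∀ p : PrimeSpectrum R, Order.coheight p = (d : ℕ∞) →
      Nontrivial (TopLC R a d (R ⧸ p.asIdeal)) := by
  induction d with
  | zero =>
    intro p hp
    have : p.asIdeal.IsMaximal := by
      rw [← PrimeSpectrum.isMax_iff, ← Order.coheight_eq_zero]
      exact_mod_cast hp
    exact TopLC.zero_quotient_nontrivial ((hmx _ p.isPrime).mpr this) p.isPrime.ne_top
  | succ d ih =>
    intro p hp
    by_contra hcon
    rw [not_nontrivial_iff_subsingleton] at hcon
    have hsurj : ∀ (q : PrimeSpectrum R), Order.coheight q = (d : ℕ∞) →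
        ∀ (N : Submodule R (R ⧸ p.asIdeal)) (f : N →ₗ[R] R ⧸ q.asIdeal), f ≠ 0 →
        Function.Surjective (TopLC.map a d f) := by
      intro q hq N f hf
      refine TopLC.map_surjective_of_subsingleton d f ?_ ?_
      · refine TopLC.subsingleton_of_support_le hmx hp hcon _ fun q hq ↦ ?_
        exact mem_support_quotient.mp (Module.support_subset_of_injective
          (N.subtype ∘ₗ (LinearMap.ker f).subtype)
          (N.injective_subtype.comp (Submodule.injective_subtype _)) hq)
      · refine TopLC.subsingleton_of_suppLT hmx _ _ (SuppLT.coker ?_ hf)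
        rw [hq]
        exact_mod_cast Nat.lt_succ_self d
    let π : ∀ q : PrimeSpectrum R, p ≤ q → (R ⧸ p.asIdeal →ₗ[R] R ⧸ q.asIdeal) :=
      fun q hq ↦ Submodule.factor hq
    have hπ : ∀ q hq x, π q hq (Ideal.Quotient.mk p.asIdeal x) = Ideal.Quotient.mk q.asIdeal x :=
      fun _ _ _ ↦ rfl
    have key : ∀ q hq, Order.coheight q = (d : ℕ∞) → ∀ J : Ideal R, ¬ J ≤ q.asIdeal →
        ∃ z : TopLC R a d (J.map (Ideal.Quotient.mk p.asIdeal) |>.restrictScalars R),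
          TopLC.map a d (π q hq) (TopLC.map a d (Submodule.subtype _) z) ≠ 0 := by
      intro q hq hqd J hJ
      obtain ⟨r, hrJ, hrq⟩ := SetLike.not_le_iff_exists.mp hJ
      have := ih q hqd
      obtain ⟨x, hx⟩ := exists_ne (0 : TopLC R a d (R ⧸ q.asIdeal))
      obtain ⟨z, hz⟩ := hsurj q hqd _
        (π q hq ∘ₗ ((J.map (Ideal.Quotient.mk p.asIdeal)).restrictScalars R).subtype)
        (fun h ↦ hrq (by
          have := LinearMap.congr_fun h ⟨Ideal.Quotient.mk _ r, Ideal.mem_map_of_mem _ hrJ⟩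
          exact Ideal.Quotient.eq_zero_iff_mem.mp this)) x
      refine ⟨z, ?_⟩
      rw [← LinearMap.comp_apply, ← TopLC.map_comp, hz]
      exact hx
    cases d with
    | zero =>
      have hpm : ¬ a ≤ p.asIdeal := by
        rw [hmx _ p.isPrime, ← PrimeSpectrum.isMax_iff, ← Order.coheight_eq_zero, hp]
        simp
      have := TopLC.zero_quotient_subsingleton hpm
      obtain ⟨-, ⟨q, hpq, hq⟩, -⟩ := Order.coheight_eq_coe_add_one_iff.mp hp
      obtain ⟨z, hz⟩ := key q (le_of_lt hpq) hq ⊤ (fun h ↦ q.isPrime.ne_top (top_le_iff.mp h))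
      refine hz ?_
      rw [this.elim (TopLC.map a 0 (Submodule.subtype _) z) 0, _root_.map_zero]
    | succ d =>
      have := TopLC.isArtinian hmx (d + 1) (R ⧸ p.asIdeal)
      let Q := {q : PrimeSpectrum R // p < q ∧ Order.coheight q = ((d + 1 : ℕ) : ℕ∞)}
      let K : Finset Q → Submodule R (TopLC R a (d + 1) (R ⧸ p.asIdeal)) := fun S ↦
        S.inf fun q ↦ LinearMap.ker (TopLC.map a (d + 1) (π q.1 q.2.1.le))
      obtain ⟨_, ⟨S, rfl⟩, hmin⟩ := IsArtinian.set_has_minimal (Set.range K) ⟨_, ∅, rfl⟩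
      classical
      obtain ⟨q, hpq, hqd, hqS⟩ := exists_coheight_eq_of_finset hp (S.image Subtype.val) (by
        simp only [Finset.mem_image]
        rintro _ ⟨q, -, rfl⟩
        exact q.2.2)
      obtain ⟨z, hz⟩ := key q hpq.le hqd (S.inf fun q ↦ q.1.asIdeal) (by
        rw [q.isPrime.inf_le']
        rintro ⟨i, hi, hle⟩
        have hiq : i.1 < q := lt_of_le_of_ne hle fun h ↦
          hqS (h ▸ Finset.mem_image_of_mem _ hi)
        have := Order.coheight_add_one_le hiq
        rw [hqd, i.2.2] at this
        exact absurd (by exact_mod_cast this) (Nat.not_succ_le_self (d + 1)))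
      refine hmin (K (insert ⟨q, hpq, hqd⟩ S)) ⟨_, rfl⟩ (lt_of_le_not_ge ?_ fun h ↦ ?_)
      · exact Finset.inf_mono (Finset.subset_insert _ _)
      · refine hz (LinearMap.mem_ker.mp ?_)
        refine (h.trans (Finset.inf_le (Finset.mem_insert_self _ _))) ?_
        rw [Submodule.mem_finsetInf]
        intro i hi
        rw [LinearMap.mem_ker, ← LinearMap.comp_apply, ← TopLC.map_comp]
        convert LinearMap.zero_apply z
        rw [← TopLC.map_zero]
        congr 1
        ext ⟨x, hx⟩
        have hle : (S.inf fun q ↦ q.1.asIdeal).map (Ideal.Quotient.mk p.asIdeal) ≤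
            i.1.asIdeal.map (Ideal.Quotient.mk p.asIdeal) := Ideal.map_mono (Finset.inf_le hi)
        obtain ⟨r, hr, rfl⟩ := (Ideal.mem_map_iff_of_surjective _
          Ideal.Quotient.mk_surjective).mp (hle hx)
        exact Ideal.Quotient.eq_zero_iff_mem.mpr hr

end NonvanishingQuotient

section PrimesInSupport

variable {R : Type} [CommRing R] {M : Type} [AddCommGroup M] [Module R M]

lemma exists_ne_zero_of_mem_support [Module.Finite R M] {p : PrimeSpectrum R}
    (hp : p ∈ Module.support R M) : ∃ g : M →ₗ[R] R ⧸ p.asIdeal, g ≠ 0 := by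
  let κ := p.asIdeal.ResidueField
  have := (Module.mem_support_iff_nontrivial_residueField_tensorProduct p).mp hp
  obtain ⟨v, hv⟩ := exists_ne (0 : κ ⊗[R] M)
  obtain ⟨φ, hφ⟩ : ∃ φ : Module.Dual κ (κ ⊗[R] M), φ v ≠ 0 := by
    by_contra! h
    exact hv ((Module.forall_dual_apply_eq_zero_iff κ v).mp h)
  let g : M →ₗ[R] κ := (φ.restrictScalars R) ∘ₗ TensorProduct.mk R κ M 1
  have hg : g ≠ 0 := by
    intro h
    refine hφ ?_
    have : φ = 0 := by
      refine TensorProduct.AlgebraTensorModule.curry_injective ?_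
      ext x
      exact LinearMap.congr_fun h x
    rw [this, LinearMap.zero_apply]
  obtain ⟨T, hT⟩ := (Module.Finite.fg_top : (⊤ : Submodule R M).FG)
  classical
  obtain ⟨b, hb⟩ := IsLocalization.exist_integer_multiples_of_finset
    (nonZeroDivisors (R ⧸ p.asIdeal)) (S := κ) (T.image g)
  let ι : R ⧸ p.asIdeal →ₗ[R] κ := (Algebra.linearMap (R ⧸ p.asIdeal) κ).restrictScalars R
  have hι : Function.Injective ι := IsFractionRing.injective (R ⧸ p.asIdeal) κ
  let μ : κ →ₗ[R] κ := (LinearMap.lsmul (R ⧸ p.asIdeal) κ b).restrictScalars R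
  have hrange : ∀ x, μ (g x) ∈ LinearMap.range ι := by
    have hle : Submodule.span R (T : Set M) ≤ (LinearMap.range ι).comap (μ ∘ₗ g) := by
      rw [Submodule.span_le]
      intro x hx
      exact hb (g x) (Finset.mem_image_of_mem g hx)
    intro x
    rw [hT] at hle
    exact hle (Submodule.mem_top (x := x))
  let e := LinearEquiv.ofInjective ι hι
  refine ⟨e.symm.toLinearMap ∘ₗ (μ ∘ₗ g).codRestrict _ hrange, fun h ↦ hg ?_⟩
  ext x
  have h1 : (⟨μ (g x), hrange x⟩ : LinearMap.range ι) = 0 :=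
    e.symm.map_eq_zero_iff.mp (LinearMap.congr_fun h x)
  have h2 : (b : R ⧸ p.asIdeal) • g x = 0 := congrArg Subtype.val h1
  rw [Algebra.smul_def, mul_eq_zero] at h2
  exact h2.resolve_left (IsLocalization.map_units κ b).ne_zero

lemma exists_mul_mem_of_mem_minimalPrimes [IsNoetherianRing R] {I p : Ideal R}
    (hp : p ∈ I.minimalPrimes) : ∃ s ∉ p, ∃ n : ℕ, ∀ r ∈ p ^ n, s * r ∈ I := by
  classical
  have hfin := Ideal.finite_minimalPrimes_of_isNoetherianRing R I
  have hprime : p.IsPrime := hp.1.1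
  have hJ : ¬ (hfin.toFinset.erase p).inf id ≤ p := by
    rw [hprime.inf_le']
    rintro ⟨q, hq, hqp⟩
    rw [Finset.mem_erase, Set.Finite.mem_toFinset] at hq
    exact hq.1 (le_antisymm hqp (hp.2 hq.2.1 hqp))
  obtain ⟨s, hsJ, hsp⟩ := SetLike.not_le_iff_exists.mp hJ
  obtain ⟨k, hk⟩ := I.exists_radical_pow_le_of_fg (IsNoetherian.noetherian _)
  have hle : Ideal.span {s} * p ≤ I.radical := by
    rw [← Ideal.sInf_minimalPrimes]
    refine le_sInf fun q hq ↦ ?_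
    by_cases h : q = p
    · exact h ▸ Ideal.mul_le_right
    · refine Ideal.mul_le_left.trans ((Ideal.span_singleton_le_iff_mem _).mpr ?_)
      exact (Finset.inf_le (f := id)
        (Finset.mem_erase.mpr ⟨h, hfin.mem_toFinset.mpr hq⟩)) hsJ
  refine ⟨s ^ k, fun h ↦ hsp (hprime.mem_of_pow_mem _ h), k, fun r hr ↦ ?_⟩
  refine hk (Ideal.pow_right_mono hle k ?_)
  rw [mul_pow, Ideal.span_singleton_pow]
  exact Ideal.mul_mem_mul (Ideal.mem_span_singleton_self _) hr

lemma annihilator_le_of_mem_support [Module.Finite R M] {p : PrimeSpectrum R} :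
    p ∈ Module.support R M ↔ Module.annihilator R M ≤ p.asIdeal := by
  rw [Module.support_eq_zeroLocus, PrimeSpectrum.mem_zeroLocus]
  rfl

lemma eq_of_le_of_coheight_eq {d : ℕ} {p q : PrimeSpectrum R} (hp : Order.coheight p = (d : ℕ∞))
    (hq : Order.coheight q = (d : ℕ∞)) (h : p ≤ q) : p = q := by
  refine h.eq_of_not_lt fun hlt ↦ ?_
  have := Order.coheight_add_one_le hlt
  rw [hp, hq] at this
  exact absurd (by exact_mod_cast this) (Nat.not_succ_le_self d)

lemma SuppLT.mem_minimalPrimes [Module.Finite R M] {d : ℕ} (hM : SuppLT R M (d + 1))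
    {p : PrimeSpectrum R} (hp : p ∈ Module.support R M) (hpd : Order.coheight p = (d : ℕ∞)) :
    p.asIdeal ∈ (Module.annihilator R M).minimalPrimes := by
  refine ⟨⟨p.isPrime, annihilator_le_of_mem_support.mp hp⟩, fun q hq hqp ↦ ?_⟩
  let q' : PrimeSpectrum R := ⟨q, hq.1⟩
  by_contra hpq
  have hlt : q' < p := lt_of_le_not_ge hqp hpq
  have := coheight_lt_of_lt hlt (hM q' (annihilator_le_of_mem_support.mpr hq.2))
  exact this.ne hpd

end PrimesInSupport

section SecondaryComponents

variable {R : Type} [CommRing R] {a : Ideal R} {M : Type} [AddCommGroup M] [Module R M] {d : ℕ}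

lemma mem_annihilator_range_lsmul {s : R} {I : Ideal R}
    (hI : ∀ r ∈ I, s * r ∈ Module.annihilator R M) {r : R} (hr : r ∈ I)
    (y : LinearMap.range (LinearMap.lsmul R M s)) : r • y = 0 := by
  obtain ⟨_, x, rfl⟩ := y
  refine Subtype.ext ?_
  change r • s • x = 0
  rw [smul_smul, mul_comm]
  exact Module.mem_annihilator.mp (hI r hr) x

/-- The submodule of `H^d_a(M)` generated by the local cohomology of `sM`. -/
noncomputable def topComponent (a : Ideal R) (M : Type) [AddCommGroup M] [Module R M] (d : ℕ)
    (s : R) : Submodule R (TopLC R a d M) :=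
  LinearMap.range (TopLC.map a d (LinearMap.range (LinearMap.lsmul R M s)).subtype)

lemma topComponent_smul_eq_zero {s : R} {I : Ideal R}
    (hI : ∀ r ∈ I, s * r ∈ Module.annihilator R M) {r : R} (hr : r ∈ I) :
    ∀ x ∈ topComponent a M d s, r • x = 0 := by
  rintro _ ⟨y, rfl⟩
  have h0 : LinearMap.lsmul R (LinearMap.range (LinearMap.lsmul R M s)) r = 0 :=
    LinearMap.ext fun y ↦ mem_annihilator_range_lsmul hI hr y
  have h := LinearMap.congr_fun
    (TopLC.map_lsmul a d (M := LinearMap.range (LinearMap.lsmul R M s)) r) y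
  rw [h0, TopLC.map_zero] at h
  have h' : r • y = 0 := h.symm
  rw [← _root_.map_smul, h', _root_.map_zero]

lemma topComponent_le_ker {p q : PrimeSpectrum R} (hpq : ¬ q ≤ p) {s : R} {n : ℕ}
    (hs : ∀ r ∈ q.asIdeal ^ n, s * r ∈ Module.annihilator R M) (g : M →ₗ[R] R ⧸ p.asIdeal) :
    topComponent a M d s ≤ LinearMap.ker (TopLC.map a d g) := by
  rintro _ ⟨z, rfl⟩
  rw [LinearMap.mem_ker, ← LinearMap.comp_apply, ← TopLC.map_comp]
  convert LinearMap.zero_apply z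
  rw [← TopLC.map_zero]
  congr 1
  have hqp : ¬ q.asIdeal ^ n ≤ p.asIdeal := fun h ↦ hpq (p.isPrime.le_of_pow_le h)
  obtain ⟨r, hrq, hrp⟩ := SetLike.not_le_iff_exists.mp hqp
  refine LinearMap.ext fun y ↦ smul_injective_quotient hrp ?_
  rw [LinearMap.lsmul_apply, LinearMap.lsmul_apply, ← _root_.map_smul,
    mem_annihilator_range_lsmul hs hrq, _root_.map_zero, LinearMap.zero_apply, smul_zero]

variable [IsNoetherianRing R] [Module.Finite R M]

open scoped Pointwise in
lemma topComponent_smul_surjective (hmx : ∀ p : Ideal R, p.IsPrime → (a ≤ p ↔ p.IsMaximal))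
    (hM : SuppLT R M (d + 1)) {p : PrimeSpectrum R} (hp : Order.coheight p = (d : ℕ∞)) {s : R}
    {n : ℕ} (hs : ∀ r ∈ p.asIdeal ^ n, s * r ∈ Module.annihilator R M) {r : R}
    (hr : r ∉ p.asIdeal) : ∀ x ∈ topComponent a M d s, ∃ y ∈ topComponent a M d s, r • y = x := by
  let N := LinearMap.range (LinearMap.lsmul R M s)
  have hN : SuppLT R N (d + 1) := hM.of_injective _ N.injective_subtype
  have hsurj : Function.Surjective (TopLC.map a d (LinearMap.lsmul R N r)) := by
    refine TopLC.map_surjective hmx d _ hN ?_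
    have hle : r • (⊤ : Submodule R N) ≤ LinearMap.range (LinearMap.lsmul R N r) := by
      rintro _ ⟨y, -, rfl⟩
      exact ⟨y, rfl⟩
    refine (hN.quotSMulTop fun q hq hqd hrq ↦ ?_).of_surjective (Submodule.factor hle)
      (Submodule.factor_surjective hle)
    rw [annihilator_le_of_mem_support] at hq
    have hpq : p.asIdeal ^ n ≤ q.asIdeal := fun r hr ↦
      hq (Module.mem_annihilator.mpr (mem_annihilator_range_lsmul hs hr))
    have := eq_of_le_of_coheight_eq hp hqd (q.isPrime.le_of_pow_le hpq)
    exact hr (this ▸ hrq)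
  rintro _ ⟨y, rfl⟩
  obtain ⟨z, rfl⟩ := hsurj y
  refine ⟨_, ⟨z, rfl⟩, ?_⟩
  rw [TopLC.map_lsmul, ← _root_.map_smul]
  rfl

lemma topComponent_not_le_ker (hmx : ∀ p : Ideal R, p.IsPrime → (a ≤ p ↔ p.IsMaximal))
    (hM : SuppLT R M (d + 1)) {p : PrimeSpectrum R} (hp : Order.coheight p = (d : ℕ∞)) {s : R}
    (hs : s ∉ p.asIdeal) {g : M →ₗ[R] R ⧸ p.asIdeal} (hg : g ≠ 0) :
    ¬ topComponent a M d s ≤ LinearMap.ker (TopLC.map a d g) := by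
  let N := LinearMap.range (LinearMap.lsmul R M s)
  have hN : SuppLT R N (d + 1) := hM.of_injective _ N.injective_subtype
  have hne : g ∘ₗ N.subtype ≠ 0 := by
    intro h
    refine hg (LinearMap.ext fun x ↦ smul_injective_quotient hs ?_)
    have := LinearMap.congr_fun h ⟨s • x, x, rfl⟩
    rw [LinearMap.lsmul_apply, LinearMap.lsmul_apply, ← _root_.map_smul, LinearMap.zero_apply,
      smul_zero]
    exact this
  have hsurj := TopLC.map_surjective hmx d _ hN (SuppLT.coker (by
    rw [hp]; exact_mod_cast Nat.lt_succ_self d) hne)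
  have := TopLC.quotient_nontrivial hmx d p hp
  obtain ⟨x, hx⟩ := exists_ne (0 : TopLC R a d (R ⧸ p.asIdeal))
  obtain ⟨z, rfl⟩ := hsurj x
  intro hle
  refine hx ?_
  rw [TopLC.map_comp]
  exact hle ⟨z, rfl⟩

lemma iSup_topComponent (hmx : ∀ p : Ideal R, p.IsPrime → (a ≤ p ↔ p.IsMaximal))
    (hM : SuppLT R M (d + 1)) {ι : Type} [Finite ι] (s : ι → R)
    (hs : ∀ p ∈ Module.support R M, Order.coheight p = (d : ℕ∞) → ∃ i, s i ∉ p.asIdeal) :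
    ⨆ i, topComponent a M d (s i) = ⊤ := by
  classical
  have := Fintype.ofFinite ι
  let N : ι → Submodule R M := fun i ↦ LinearMap.range (LinearMap.lsmul R M (s i))
  let Φ : ((i : ι) → N i) →ₗ[R] M := ∑ i, (N i).subtype ∘ₗ LinearMap.proj i
  have hΦ : ∀ i, N i ≤ LinearMap.range Φ := by
    intro i x hx
    refine ⟨LinearMap.single R (fun i ↦ N i) i ⟨x, hx⟩, ?_⟩
    rw [LinearMap.sum_apply, Finset.sum_eq_single i]
    · simp
    · intro j _ hj
      simp [Pi.single_eq_of_ne hj]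
    · simp
  have hsupp : SuppLT R ((i : ι) → N i) (d + 1) := by
    intro p hp
    obtain ⟨x, hx⟩ := Module.mem_support_iff_exists_annihilator.mp hp
    refine hM p (annihilator_le_of_mem_support.mpr (le_trans (fun r hr ↦ ?_) hx))
    rw [Submodule.mem_annihilator_span_singleton]
    exact funext fun i ↦ Subtype.ext (Module.mem_annihilator.mp hr _)
  have hcoker : SuppLT R (M ⧸ LinearMap.range Φ) d := by
    intro p hp
    have hpM := Module.support_subset_of_surjective _ (LinearMap.range Φ).mkQ_surjective hp
    have h1 := hM p hpM
    push_cast at h1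
    refine lt_of_le_of_ne (Order.le_of_lt_add_one h1) fun h2 ↦ ?_
    obtain ⟨i, hi⟩ := hs p hpM h2
    refine hi (annihilator_le_of_mem_support.mp hp (Module.mem_annihilator.mpr fun x ↦ ?_))
    obtain ⟨x, rfl⟩ := Submodule.mkQ_surjective _ x
    rw [← _root_.map_smul, Submodule.mkQ_apply, Submodule.Quotient.mk_eq_zero]
    exact hΦ i ⟨x, rfl⟩
  have hsurj := TopLC.map_surjective hmx d Φ hsupp hcoker
  refine eq_top_iff.mpr fun x _ ↦ ?_
  obtain ⟨z, rfl⟩ := hsurj x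
  have hmap : TopLC.map a d Φ =
      ∑ i, TopLC.map a d (N i).subtype ∘ₗ TopLC.map a d (LinearMap.proj i) := by
    have := _root_.map_sum (TopLC.mapₗ a d ((i : ι) → N i) M)
      (fun i ↦ (N i).subtype ∘ₗ LinearMap.proj i) Finset.univ
    refine this.trans (Finset.sum_congr rfl fun i _ ↦ TopLC.map_comp a d _ _)
  rw [hmap, LinearMap.sum_apply]
  exact Submodule.sum_mem _ fun i _ ↦ Submodule.mem_iSup_of_mem i ⟨_, rfl⟩

end SecondaryComponents

section AttachedPrimes

variable {R : Type} [CommRing R] {H : Type} [AddCommGroup H] [Module R H]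

lemma IsSecondarySub.smul_surjective {S : Submodule R H} (hS : IsSecondarySub R S) {r : R}
    (hr : r ∉ S.annihilator.radical) : ∀ m ∈ S, ∃ s ∈ S, r • s = m := by
  refine (hS.2 r).resolve_right ?_
  rintro ⟨n, hn⟩
  exact hr ⟨n, Submodule.mem_annihilator.mpr hn⟩

lemma IsSecondarySub.pow_smul_surjective {S : Submodule R H} (hS : IsSecondarySub R S) {r : R}
    (hr : r ∉ S.annihilator.radical) (n : ℕ) : ∀ m ∈ S, ∃ s ∈ S, r ^ n • s = m := by
  induction n with
  | zero => exact fun m hm ↦ ⟨m, hm, by rw [pow_zero, one_smul]⟩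
  | succ n ih =>
    intro m hm
    obtain ⟨s, hs, rfl⟩ := hS.smul_surjective hr m hm
    obtain ⟨u, hu, rfl⟩ := ih s hs
    exact ⟨u, hu, by rw [pow_succ', mul_smul]⟩

lemma IsSecondarySub.isPrime {S : Submodule R H} (hS : IsSecondarySub R S) :
    S.annihilator.radical.IsPrime := by
  have hsurj := fun r (hr : r ∉ S.annihilator.radical) ↦ hS.smul_surjective hr
  have hpow := fun r (hr : r ∉ S.annihilator.radical) n ↦ hS.pow_smul_surjective hr n
  refine ⟨fun h ↦ hS.1 ?_, fun {x y} hxy ↦ ?_⟩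
  · rw [Ideal.radical_eq_top] at h
    exact Submodule.annihilator_eq_top_iff.mp h
  · by_contra! hcon
    obtain ⟨n, hn⟩ := hxy
    rw [Submodule.mem_annihilator] at hn
    refine hS.1 ((Submodule.eq_bot_iff _).mpr fun m hm ↦ ?_)
    obtain ⟨u, hu, rfl⟩ := hpow x hcon.1 n m hm
    obtain ⟨v, hv, rfl⟩ := hpow y hcon.2 n u hu
    rw [smul_smul, ← mul_pow]
    exact hn v hv

/-- A nonzero quotient `S / (S ⊓ K)` of a secondary submodule has the same attached prime. -/
lemma radical_colon_eq {S K : Submodule R H} (hS : IsSecondarySub R S) (hSK : ¬ S ≤ K) (r : R) :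
    (∃ n : ℕ, ∀ x ∈ S, r ^ n • x ∈ K) ↔ r ∈ S.annihilator.radical := by
  constructor
  · rintro ⟨n, hn⟩
    by_contra hr
    refine hSK fun x hx ↦ ?_
    obtain ⟨y, hy, rfl⟩ := hS.pow_smul_surjective hr n x hx
    exact hn y hy
  · rintro ⟨n, hn⟩
    exact ⟨n, fun x hx ↦ Submodule.mem_annihilator.mp hn x hx ▸ K.zero_mem⟩

lemma IsMinimalRep.exists_radical_eq {n n' : ℕ} {S : Fin n → Submodule R H}
    {T : Fin n' → Submodule R H} (hS : IsMinimalRep R S) (hT : IsMinimalRep R T) (i : Fin n) :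
    ∃ j, (S i).annihilator.radical = (T j).annihilator.radical := by
  classical
  obtain ⟨hS₁, hS₂, -, hS₄⟩ := hS
  obtain ⟨hT₁, hT₂, -, -⟩ := hT
  let K : Submodule R H := ⨆ k ∈ ({i}ᶜ : Set (Fin n)), S k
  have hK : ¬ S i ≤ K := hS₄ i
  have hsup : S i ⊔ K = ⊤ := by
    rw [eq_top_iff, ← hS₂]
    refine iSup_le fun k ↦ ?_
    by_cases h : k = i
    · exact h ▸ le_sup_left
    · exact (le_iSup₂_of_le (f := fun k (_ : k ∈ ({i}ᶜ : Set (Fin n))) ↦ S k) k h le_rfl).trans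
        le_sup_right
  have hall : ∀ r ∈ (S i).annihilator.radical, ∃ n : ℕ, ∀ x : H, r ^ n • x ∈ K := by
    rintro r ⟨n, hn⟩
    refine ⟨n, fun x ↦ ?_⟩
    obtain ⟨y, hy, z, hz, rfl⟩ := Submodule.mem_sup.mp (hsup ▸ Submodule.mem_top : x ∈ S i ⊔ K)
    rw [smul_add, Submodule.mem_annihilator.mp hn y hy, zero_add]
    exact K.smul_mem _ hz
  let J : Finset (Fin n') := Finset.univ.filter fun j ↦ ¬ T j ≤ K
  have hle : J.inf (fun j ↦ (T j).annihilator.radical) ≤ (S i).annihilator.radical := by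
    intro r hr
    have hex : ∀ j, ∃ n : ℕ, ∀ x ∈ T j, r ^ n • x ∈ K := by
      intro j
      by_cases hj : T j ≤ K
      · exact ⟨0, fun x hx ↦ K.smul_mem _ (hj hx)⟩
      · exact (radical_colon_eq (hT₁ j) hj r).mpr
          ((Finset.inf_le (f := fun j ↦ (T j).annihilator.radical)
            (Finset.mem_filter.mpr ⟨Finset.mem_univ j, hj⟩)) hr)
    choose e he using hex
    rw [← radical_colon_eq (hS₁ i) hK r]
    refine ⟨∑ j, e j, fun x _ ↦ ?_⟩
    have htop : (⨆ j, T j) ≤ K.comap (LinearMap.lsmul R H (r ^ ∑ j, e j)) := by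
      refine iSup_le fun j x hx ↦ ?_
      have hj : e j ≤ ∑ j, e j := Finset.single_le_sum (f := e) (fun _ _ ↦ Nat.zero_le _)
        (Finset.mem_univ j)
      rw [Submodule.mem_comap, LinearMap.lsmul_apply, ← Nat.sub_add_cancel hj, pow_add, mul_smul]
      exact K.smul_mem _ (he j x hx)
    rw [hT₂] at htop
    exact htop Submodule.mem_top
  obtain ⟨j, hj, hjle⟩ := (hS₁ i).isPrime.inf_le'.mp hle
  refine ⟨j, le_antisymm (fun r hr ↦ ?_) hjle⟩
  obtain ⟨n, hn⟩ := hall r hr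
  exact (radical_colon_eq (hT₁ j) (Finset.mem_filter.mp hj).2 r).mp ⟨n, fun x _ ↦ hn x⟩

lemma IsMinimalRep.attachedPrimes_eq {n : ℕ} {S : Fin n → Submodule R H}
    (hS : IsMinimalRep R S) :
    AttachedPrimes R H = Set.range fun i ↦ (S i).annihilator.radical := by
  ext p
  constructor
  · rintro ⟨n', T, hT, j, rfl⟩
    obtain ⟨i, hi⟩ := hT.exists_radical_eq hS j
    exact ⟨i, hi.symm⟩
  · rintro ⟨i, rfl⟩
    exact ⟨n, S, hS, i, rfl⟩

/-- Assemble a minimal secondary representation from components indexed by a finite set of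
distinct primes. -/
lemma attachedPrimes_eq_range {ι : Type} [Finite ι] (p : ι → Ideal R) (hp : Function.Injective p)
    (S K : ι → Submodule R H) (hpow : ∀ i, ∀ r ∈ p i, ∃ n : ℕ, ∀ x ∈ S i, r ^ n • x = 0)
    (hsurj : ∀ i, ∀ r ∉ p i, ∀ x ∈ S i, ∃ y ∈ S i, r • y = x) (htop : ⨆ i, S i = ⊤)
    (hK : ∀ i, ¬ S i ≤ K i) (hK' : ∀ i j, j ≠ i → S j ≤ K i) :
    AttachedPrimes R H = Set.range p := by
  have hsec : ∀ i, IsSecondarySub R (S i) := fun i ↦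
    ⟨fun h ↦ hK i (h ▸ bot_le), fun r ↦ by
      by_cases hr : r ∈ p i
      · exact Or.inr (hpow i r hr)
      · exact Or.inl (hsurj i r hr)⟩
  have hrad : ∀ i, (S i).annihilator.radical = p i := by
    intro i
    ext r
    constructor
    · intro hr
      by_contra hrp
      obtain ⟨n, hn⟩ := hr
      rw [Submodule.mem_annihilator] at hn
      have hind : ∀ k : ℕ, (∀ x ∈ S i, r ^ k • x = 0) → ∀ x ∈ S i, x = 0 := by
        intro k
        induction k with
        | zero => exact fun h x hx ↦ by simpa using h x hx
        | succ k ih =>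
          intro h
          refine ih fun x hx ↦ ?_
          obtain ⟨y, hy, rfl⟩ := hsurj i r hrp x hx
          rw [smul_smul, ← pow_succ]
          exact h y hy
      exact (hsec i).1 ((Submodule.eq_bot_iff _).mpr (hind n hn))
    · intro hr
      obtain ⟨n, hn⟩ := hpow i r hr
      exact ⟨n, Submodule.mem_annihilator.mpr hn⟩
  obtain ⟨n, ⟨e⟩⟩ := Finite.exists_equiv_fin ι
  have hmin : IsMinimalRep R (S ∘ e.symm) := by
    refine ⟨fun i ↦ hsec _, ?_, ?_, fun j hj ↦ ?_⟩
    · rw [← htop]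
      exact e.symm.iSup_comp (g := S)
    · intro i j hij
      simp only [Function.comp_apply, hrad] at hij
      exact e.symm.injective (hp hij)
    · refine hK (e.symm j) (hj.trans (iSup₂_le fun i hi ↦ hK' _ _ fun h ↦ hi ?_))
      exact e.symm.injective h
  rw [hmin.attachedPrimes_eq]
  simp only [Function.comp_apply, hrad]
  exact e.symm.surjective.range_comp p

lemma nontrivial_of_attachedPrimes_nonempty (h : (AttachedPrimes R H).Nonempty) : Nontrivial H := by
  obtain ⟨_, n, S, hS, i, -⟩ := h
  by_contra hcon
  rw [not_nontrivial_iff_subsingleton] at hcon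
  exact (hS.1 i).1 (Subsingleton.elim _ _)

end AttachedPrimes

section Assh

variable {R : Type} [CommRing R] {M : Type} [AddCommGroup M] [Module R M]

lemma ringKrullDim_quotient_eq_coheight (p : PrimeSpectrum R) :
    ringKrullDim (R ⧸ p.asIdeal) = (Order.coheight p : WithBot ℕ∞) := by
  rw [ringKrullDim_quotient, Order.coheight_eq_krullDim_Ici]
  rfl

lemma coheight_support (q : Module.support R M) : Order.coheight q = Order.coheight q.1 := by
  rw [← WithBot.coe_inj, Order.coheight_eq_krullDim_Ici, Order.coheight_eq_krullDim_Ici]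
  refine Order.krullDim_eq_of_orderIso
    { toFun := fun x ↦ ⟨x.1.1, x.2⟩
      invFun := fun x ↦ ⟨⟨x.1, Module.mem_support_mono x.2 q.2⟩, x.2⟩
      left_inv := fun _ ↦ rfl
      right_inv := fun _ ↦ rfl
      map_rel_iff' := Iff.rfl }

lemma SuppLT.of_moduleDim {d : ℕ} (hd : moduleDim R M = (d : WithBot ℕ∞)) :
    SuppLT R M (d + 1) := by
  intro p hp
  have h := Order.coheight_le_krullDim (⟨p, hp⟩ : Module.support R M)
  rw [coheight_support, show Order.krullDim (Module.support R M) = _ from hd] at h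
  have h' : Order.coheight p ≤ (d : ℕ∞) := by exact_mod_cast h
  exact h'.trans_lt (by exact_mod_cast Nat.lt_succ_self d)

lemma exists_mem_support_coheight_eq {d : ℕ} (hd : moduleDim R M = (d : WithBot ℕ∞)) :
    ∃ p ∈ Module.support R M, Order.coheight p = (d : ℕ∞) := by
  obtain ⟨l, hl⟩ := Order.le_krullDim_iff.mp (show (d : WithBot ℕ∞) ≤
    Order.krullDim (Module.support R M) from hd.ge)
  refine ⟨l.head.1, l.head.2, le_antisymm ?_ ?_⟩
  · exact Order.le_of_lt_add_one (by simpa using SuppLT.of_moduleDim hd _ l.head.2)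
  · rw [← coheight_support, ← hl]
    exact Order.length_le_coheight le_rfl

lemma assh_eq [IsNoetherianRing R] [Module.Finite R M] {d : ℕ}
    (hd : moduleDim R M = (d : WithBot ℕ∞)) :
    Assh R M = PrimeSpectrum.asIdeal ''
      {p | p ∈ Module.support R M ∧ Order.coheight p = (d : ℕ∞)} := by
  ext p
  constructor
  · rintro ⟨hp, hpd⟩
    refine ⟨⟨p, hp.isPrime⟩, ⟨?_, ?_⟩, rfl⟩
    · exact annihilator_le_of_mem_support.mpr
        (Submodule.annihilator_top (R := R) (M := M) ▸ hp.annihilator_le)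
    · have := ringKrullDim_quotient_eq_coheight ⟨p, hp.isPrime⟩
      rw [hpd, hd] at this
      exact_mod_cast this.symm
  · rintro ⟨p, ⟨hp, hpd⟩, rfl⟩
    refine ⟨Module.associatedPrimes.minimalPrimes_annihilator_subset_associatedPrimes R M
      ((SuppLT.of_moduleDim hd).mem_minimalPrimes hp hpd), ?_⟩
    rw [ringKrullDim_quotient_eq_coheight, hpd, hd]
    rfl

end Assh

section MainResult

variable {R : Type} [CommRing R] [IsNoetherianRing R] {a : Ideal R} {M : Type} [AddCommGroup M]
  [Module R M] [Module.Finite R M] {d : ℕ}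

lemma attachedPrimes_topLC (hmx : ∀ p : Ideal R, p.IsPrime → (a ≤ p ↔ p.IsMaximal))
    (hM : SuppLT R M (d + 1)) : AttachedPrimes R (TopLC R a d M) =
      PrimeSpectrum.asIdeal '' {p | p ∈ Module.support R M ∧ Order.coheight p = (d : ℕ∞)} := by
  let P := {p : PrimeSpectrum R // p ∈ Module.support R M ∧ Order.coheight p = (d : ℕ∞)}
  have hinj : Function.Injective fun p : P ↦ p.1.asIdeal := fun p q h ↦
    Subtype.ext (PrimeSpectrum.ext h)
  have hminp : ∀ p : P, p.1.asIdeal ∈ (Module.annihilator R M).minimalPrimes := fun p ↦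
    hM.mem_minimalPrimes p.2.1 p.2.2
  have : Finite P := by
    have := (Ideal.finite_minimalPrimes_of_isNoetherianRing R
      (Module.annihilator R M)).to_subtype
    exact Finite.of_injective (fun p : P ↦
      (⟨_, hminp p⟩ : (Module.annihilator R M).minimalPrimes))
      fun p q h ↦ hinj (congrArg Subtype.val h)
  choose s hs n hn using fun p : P ↦ exists_mul_mem_of_mem_minimalPrimes (hminp p)
  choose g hg using fun p : P ↦ exists_ne_zero_of_mem_support p.2.1
  rw [attachedPrimes_eq_range (fun p : P ↦ p.1.asIdeal) hinj (fun p ↦ topComponent a M d (s p))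
    (fun p ↦ LinearMap.ker (TopLC.map a d (g p)))
    (fun p r hr ↦ ⟨n p, topComponent_smul_eq_zero (hn p) (Ideal.pow_mem_pow hr _)⟩)
    (fun p r hr ↦ topComponent_smul_surjective hmx hM p.2.2 (hn p) hr)
    (iSup_topComponent hmx hM s fun p hp hpd ↦ ⟨⟨p, hp, hpd⟩, hs ⟨p, hp, hpd⟩⟩)
    (fun p ↦ topComponent_not_le_ker hmx hM p.2.2 (hs p) (hg p))
    (fun p q hqp ↦ topComponent_le_ker
      (fun h ↦ hqp (Subtype.ext (eq_of_le_of_coheight_eq q.2.2 p.2.2 h))) (hn q) (g p))]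
  ext I
  constructor
  · rintro ⟨p, rfl⟩
    exact ⟨p.1, p.2, rfl⟩
  · rintro ⟨p, hp, rfl⟩
    exact ⟨⟨p, hp⟩, rfl⟩

end MainResult

/-- If `R` is a Noetherian semi-local ring with maximal ideals exactly
`m_1, …, m_t`, `a = ∩ᵢ m_i` is the Jacobson radical, and `M` is a finitely generated module of
finite dimension `d`, then `Att_R H^d_a(M) = Assh_R M`; in particular `M ≠ 0 → H^d_a(M) ≠ 0`. -/
theorem stmt_15 (R : Type) [CommRing R] [IsNoetherianRing R] (t : ℕ)
    (m : Fin t → Ideal R)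
    (hmax : ∀ I : Ideal R, I.IsMaximal ↔ ∃ i, I = m i)
    (M : Type) [AddCommGroup M] [Module R M] [Module.Finite R M]
    (d : ℕ) (hd : moduleDim R M = (d : WithBot ℕ∞))
    (a : Ideal R) (ha : a = ⨅ i, m i) :
    AttachedPrimes R (TopLC R a d M) = Assh R M ∧
      (Nontrivial M → Nontrivial (TopLC R a d M)) := by
  have hmx : ∀ p : Ideal R, p.IsPrime → (a ≤ p ↔ p.IsMaximal) := by
    intro p hp
    refine ⟨fun hle ↦ ?_, fun hpm ↦ ?_⟩
    · rw [ha, ← Finset.inf_univ_eq_iInf, hp.inf_le'] at hle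
      obtain ⟨i, -, hi⟩ := hle
      have hi' : (m i).IsMaximal := (hmax _).mpr ⟨i, rfl⟩
      exact hi'.eq_of_le hp.ne_top hi ▸ hi'
    · obtain ⟨i, rfl⟩ := (hmax p).mp hpm
      exact ha ▸ iInf_le m i
  have hatt : AttachedPrimes R (TopLC R a d M) = Assh R M := by
    rw [attachedPrimes_topLC hmx (SuppLT.of_moduleDim hd), assh_eq hd]
  refine ⟨hatt, fun _ ↦ nontrivial_of_attachedPrimes_nonempty (R := R) ?_⟩
  obtain ⟨p, hp⟩ := exists_mem_support_coheight_eq hd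
  rw [hatt, assh_eq hd]
  exact ⟨_, p, hp, rfl⟩
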